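/- arXiv:2411.17322 — 2 statements merged into one kernel-verified Lean document; each statement's English description precedes it below -/
import Mathlib

section
/- Let k ≥ 6 be even, t = (k-2)/2, and let F be a graph with p(F) ≥ t+1 satisfying ex(k-1,F)/(k-2) ≤ (k-2)/2. Then there exist constants C = C(k,F) and N = N(k,F) such that for all n ≥ N, | ex(n, {𝓒_{≥k}, F}) − ((k-2)/2)·n | ≤ C. -/
open SimpleGraph

section Defs

variable {V α β : Type*}

/-- `G` contains a copy of `F` as a (not necessarily induced) subgraph. -/
def ContainsCopy (F : SimpleGraph α) (G : SimpleGraph β) : Prop :=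
  ∃ f : α → β, Function.Injective f ∧ ∀ ⦃a b⦄, F.Adj a b → G.Adj (f a) (f b)

/-- The number of edges of `G`. -/
noncomputable def edgeCount (G : SimpleGraph V) : ℕ := G.edgeSet.ncard

/-- `G` has a cycle of length at least `k`, i.e. `G` is not `𝓒_{≥k}`-free. -/
def HasCycleGE (G : SimpleGraph V) (k : ℕ) : Prop :=
  ∃ (v : V) (w : G.Walk v v), w.IsCycle ∧ k ≤ w.length

/-- `G` is 2-connected: it has at least 3 vertices, is connected, and stays
connected after deleting any single vertex. -/
def TwoConnected [Fintype V] (G : SimpleGraph V) : Prop :=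
  3 ≤ Fintype.card V ∧ G.Connected ∧ ∀ v : V, (G.induce ({v}ᶜ : Set V)).Connected

/-- `p(F) ≥ s`: for every proper 2-coloring of `F` both color classes have size
at least `s` (vacuously true for nonbipartite `F`, where `p(F) = ∞`). -/
def PGE [Fintype α] (F : SimpleGraph α) (s : ℕ) : Prop :=
  ∀ c : α → Bool, (∀ a b, F.Adj a b → c a ≠ c b) →
    s ≤ {a | c a = true}.ncard ∧ s ≤ {a | c a = false}.ncard

/-- `S` is a vertex covering of `F`: the complement of `S` is independent. -/
def IsVertexCovering (F : SimpleGraph α) (S : Set α) : Prop :=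
  ∀ a b, a ∉ S → b ∉ S → ¬ F.Adj a b

/-- `G` is `𝓗`-free, where `𝓗 = {F[S] : S is a vertex covering of F}`. -/
def CoverFree (F : SimpleGraph α) (G : SimpleGraph β) : Prop :=
  ∀ S : Set α, IsVertexCovering F S → ¬ ContainsCopy (F.induce S) G

/-- The maximum number of edges of an `n`-vertex graph satisfying `P`
(a generic Turán-type extremal number). -/
noncomputable def exMax (n : ℕ) (P : SimpleGraph (Fin n) → Prop) : ℕ :=
  sSup {m | ∃ G : SimpleGraph (Fin n), P G ∧ edgeCount G = m}

/-- The number of edges of `G` with both endpoints in `T`, i.e. `e(G[T])`. -/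
noncomputable def edgesWithin (G : SimpleGraph V) (T : Set V) : ℕ :=
  {e ∈ G.edgeSet | ∀ x ∈ e, x ∈ T}.ncard

/-- The number of edges of `G` with both endpoints outside `T`, i.e. `e(G−T)`. -/
noncomputable def edgesOutside (G : SimpleGraph V) (T : Set V) : ℕ :=
  {e ∈ G.edgeSet | ∀ x ∈ e, x ∉ T}.ncard

/-- The number of edges of `G` with exactly one endpoint in `T`, i.e. `e(G−T, T)`. -/
noncomputable def edgesCross (G : SimpleGraph V) (T : Set V) : ℕ :=
  {e ∈ G.edgeSet | ∃ a b, e = s(a, b) ∧ a ∈ T ∧ b ∉ T}.ncard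

/-- The number of neighbors of `u` lying in `T` (e.g. `d_C(u)` for `T = V(C)`). -/
noncomputable def degOn (G : SimpleGraph V) (T : Set V) (u : V) : ℕ :=
  {x ∈ T | G.Adj u x}.ncard

/-- The join `T ∨ I_b` of a graph `T` on `Fin a` with an independent set of
`b` vertices. -/
def joinIndep (a b : ℕ) (T : SimpleGraph (Fin a)) : SimpleGraph (Fin a ⊕ Fin b) :=
  SimpleGraph.fromRel (fun x y =>
    x.isLeft ≠ y.isLeft ∨ ∃ u v, x = Sum.inl u ∧ y = Sum.inl v ∧ T.Adj u v)

end Defs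


namespace DiracAux

variable {V : Type*} {G : SimpleGraph V}

/-- There is a path from `u` to `v` whose vertex set is `S`. -/
def PathS (G : SimpleGraph V) (u v : V) (S : Set V) : Prop :=
  ∃ p : G.Walk u v, p.IsPath ∧ {x | x ∈ p.support} = S

theorem PathS.refl (u : V) : PathS G u u {u} :=
  ⟨Walk.nil, by simp, by ext; simp⟩

theorem PathS.left_mem {u v : V} {S : Set V} (h : PathS G u v S) : u ∈ S := by
  obtain ⟨p, hp, rfl⟩ := h
  simp

theorem PathS.right_mem {u v : V} {S : Set V} (h : PathS G u v S) : v ∈ S := by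
  obtain ⟨p, hp, rfl⟩ := h
  simp

theorem PathS.finite {u v : V} {S : Set V} (h : PathS G u v S) : S.Finite := by
  obtain ⟨p, hp, rfl⟩ := h
  exact List.finite_toSet p.support

theorem PathS.symm {u v : V} {S : Set V} (h : PathS G u v S) : PathS G v u S := by
  obtain ⟨p, hp, rfl⟩ := h
  exact ⟨p.reverse, hp.reverse, by ext; simp⟩

theorem PathS.append {u v w : V} {S T : Set V} (h : PathS G u v S) (h' : PathS G v w T)
    (hST : ∀ x, x ∈ S → x ∈ T → x = v) : PathS G u w (S ∪ T) := by
  obtain ⟨p, hp, rfl⟩ := h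
  obtain ⟨q, hq, rfl⟩ := h'
  refine ⟨p.append q, ?_, ?_⟩
  · rw [Walk.isPath_def, Walk.support_append, List.nodup_append]
    have h2 := hq.support_nodup
    rw [← Walk.cons_tail_support] at h2
    rw [List.nodup_cons] at h2
    refine ⟨hp.support_nodup, h2.2, ?_⟩
    intro a ha b hb hab
    subst hab
    have := hST a ha (List.mem_of_mem_tail hb)
    subst this
    exact h2.1 hb
  · ext x
    simp [Walk.mem_support_append_iff]

theorem PathS.edge {u v : V} (h : G.Adj u v) : PathS G u v {u, v} := by
  refine ⟨Walk.cons h Walk.nil, ?_, ?_⟩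
  · simp [h.ne]
  · ext; simp

theorem PathS.cons {u v w : V} {S : Set V} (h : G.Adj u v) (h' : PathS G v w S) (hu : u ∉ S) :
    PathS G u w (insert u S) := by
  obtain ⟨p, hp, rfl⟩ := h'
  refine ⟨Walk.cons h p, ?_, ?_⟩
  · rw [Walk.cons_isPath_iff]
    exact ⟨hp, hu⟩
  · ext; simp

/-- join two disjoint paths by an edge -/
theorem PathS.join {u v w z : V} {S T : Set V} (h : PathS G u v S) (hvw : G.Adj v w)
    (h' : PathS G w z T) (hST : ∀ x, x ∈ S → x ∉ T) : PathS G u z (S ∪ T) := by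
  have h1 := PathS.cons hvw h' (hST v h.right_mem)
  have h2 := h.append h1 (by
    intro x hx hx'
    rcases hx' with hx' | hx'
    · exact hx'
    · exact absurd hx' (hST x hx))
  have : S ∪ insert v T = S ∪ T := by
    ext x
    have := h.right_mem
    simp only [Set.mem_union, Set.mem_insert_iff]
    constructor
    · rintro (h | rfl | h) <;> tauto
    · tauto
  rwa [this] at h2

theorem PathS.split {u v x : V} {S : Set V} (h : PathS G u v S) (hx : x ∈ S) :
    ∃ S₁ S₂, PathS G u x S₁ ∧ PathS G x v S₂ ∧ S₁ ∪ S₂ = S ∧ (∀ y, y ∈ S₁ → y ∈ S₂ → y = x) := by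
  classical
  obtain ⟨p, hp, rfl⟩ := h
  have hx' : x ∈ p.support := hx
  refine ⟨_, _, ⟨p.takeUntil x hx', hp.takeUntil hx', rfl⟩,
    ⟨p.dropUntil x hx', hp.dropUntil hx', rfl⟩, ?_, ?_⟩
  · ext y
    have := Walk.mem_support_append_iff (t := y) (p.takeUntil x hx') (p.dropUntil x hx')
    rw [p.take_spec hx'] at this
    exact this.symm
  · intro y hy1 hy2
    by_contra hne
    have h3 : ((p.takeUntil x hx').append (p.dropUntil x hx')).IsPath := by
      rw [p.take_spec hx']; exact hp
    have h4 := h3.support_nodup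
    rw [Walk.support_append, List.nodup_append] at h4
    have hy2' : y ∈ (p.dropUntil x hx').support := hy2
    rw [← Walk.cons_tail_support] at hy2'
    rcases List.mem_cons.1 hy2' with h | h
    · exact hne h
    · exact h4.2.2 y hy1 y h rfl

theorem PathS.uncons {u v : V} {S : Set V} (h : PathS G u v S) :
    (u = v ∧ S = {u}) ∨ ∃ y, G.Adj u y ∧ PathS G y v (S \ {u}) := by
  obtain ⟨p, hp, rfl⟩ := h
  cases p with
  | nil => left; refine ⟨rfl, ?_⟩; ext; simp
  | cons h q =>
    right
    rw [Walk.cons_isPath_iff] at hp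
    refine ⟨_, h, q, hp.1, ?_⟩
    ext x
    simp only [Walk.support_cons, List.mem_cons, Set.mem_ofPred_eq, Set.mem_sdiff,
      Set.mem_singleton_iff]
    constructor
    · intro hx
      refine ⟨Or.inr hx, ?_⟩
      rintro rfl
      exact hp.2 hx
    · tauto

/-- closing a path gives a cycle -/
theorem PathS.cycle {u v : V} {S : Set V} (h : PathS G u v S) (hvu : G.Adj v u)
    (h3 : 3 ≤ S.ncard) : HasCycleGE G S.ncard := by
  classical
  obtain ⟨p, hp, rfl⟩ := h
  have hc : {x | x ∈ p.support}.ncard = p.length + 1 := by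
    rw [← Walk.length_support, ← List.toFinset_card_of_nodup hp.support_nodup,
      ← Set.ncard_coe_finset]
    congr 1
    ext; simp
  rw [hc] at h3 ⊢
  refine ⟨v, Walk.cons hvu p, ?_, by simp⟩
  rw [Walk.cons_isCycle_iff]
  refine ⟨hp, ?_⟩
  intro hmem
  have hlen : p.length = 1 := by
    cases p with
    | nil => simp at h3
    | cons hh q =>
      rw [Walk.cons_isPath_iff] at hp
      rw [Walk.edges_cons, List.mem_cons] at hmem
      rcases hmem with hm | hm
      · rw [Sym2.eq_iff] at hm
        rcases hm with ⟨h1, h2⟩ | ⟨h1, h2⟩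
        · exact absurd h1 hvu.ne
        · subst h1
          have := (Walk.isPath_iff_nil.1 hp.1).eq_nil
          subst this
          simp
      · exact absurd (Walk.snd_mem_support_of_mem_edges q hm) hp.2
  omega

/-- two internally disjoint paths give a cycle -/
theorem PathS.cycle₂ {u v : V} {S T : Set V} (h : PathS G u v S) (h' : PathS G u v T)
    (huv : u ≠ v) (hST : ∀ x, x ∈ S → x ∈ T → x = u ∨ x = v) (h3 : 3 ≤ (S ∪ T).ncard) :
    HasCycleGE G (S ∪ T).ncard := by
  rcases h'.uncons with ⟨h1, -⟩ | ⟨y, hy, hP⟩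
  · exact absurd h1 huv
  have h2 := h.append hP.symm (by
    rintro x hx ⟨hx', hx''⟩
    rcases hST x hx hx' with h | h
    · exact absurd h hx''
    · exact h)
  have h4 : S ∪ T \ {u} = S ∪ T := by
    ext x
    have := h.left_mem
    simp only [Set.mem_union, Set.mem_sdiff, Set.mem_singleton_iff]
    constructor
    · tauto
    · rintro (h | h)
      · exact Or.inl h
      · by_cases hx : x = u
        · subst hx; left; assumption
        · exact Or.inr ⟨h, hx⟩
  rw [h4] at h2
  exact h2.cycle hy.symm h3

/-- a spanning closed path can be started anywhere -/
theorem PathS.rotate {u v z : V} {S : Set V} (h : PathS G u v S) (hvu : G.Adj v u) (hz : z ∈ S) :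
    ∃ z', PathS G z z' S := by
  obtain ⟨S₁, S₂, h1, h2, h12, hd⟩ := h.split hz
  rcases h1.symm.uncons with ⟨h3, -⟩ | ⟨y, hy, hP⟩
  · subst h3
    exact ⟨v, h⟩
  · refine ⟨y, ?_⟩
    have h5 := h2.join hvu hP.symm (by
      rintro x hx ⟨hx', hx''⟩
      exact hx'' (hd x hx' hx))
    have : S₂ ∪ S₁ \ {z} = S := by
      rw [← h12]
      ext x
      have := h2.left_mem
      simp only [Set.mem_union, Set.mem_sdiff, Set.mem_singleton_iff]
      constructor
      · tauto
      · rintro (h | h)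
        · by_cases hx : x = z
          · subst hx; left; assumption
          · exact Or.inr ⟨h, hx⟩
        · exact Or.inl h
    rwa [this] at h5

/-- No separation by the vertex `v`. -/
def NoSep (G : SimpleGraph V) : Prop :=
  ∀ (v : V) (X Y : Set V), X ∪ Y = Set.univ → X ∩ Y ⊆ {v} →
    (∀ x ∈ X \ Y, ∀ y ∈ Y \ X, ¬ G.Adj x y) → (X \ Y).Nonempty → (Y \ X).Nonempty → False

theorem NoSep.path (hG : NoSep G) (v a b : V) (ha : a ≠ v) (hb : b ≠ v) :
    ∃ T, PathS G a b T ∧ v ∉ T := by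
  by_contra hcon
  set R : Set V := {w | ∃ T, PathS G a w T ∧ v ∉ T} with hR
  have haR : a ∈ R := ⟨{a}, PathS.refl a, by simpa using ha.symm⟩
  have hvR : v ∉ R := by
    rintro ⟨T, hT, hv⟩
    exact hv hT.right_mem
  refine hG v (R ∪ {v}) Rᶜ ?_ ?_ ?_ ?_ ?_
  · ext x; simp only [Set.mem_union, Set.mem_compl_iff, Set.mem_univ, iff_true]; tauto
  · rintro x ⟨h1 | h1, h2⟩
    · exact absurd h1 h2
    · exact h1
  · rintro x ⟨h1 | h1, h2⟩ y ⟨h3, h4⟩ hadj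
    · obtain ⟨T, hT, hv⟩ := h1
      apply h3
      have hyv : y ≠ v := by
        rintro rfl
        exact h4 (Or.inr rfl)
      by_cases hyT : y ∈ T
      · obtain ⟨S₁, S₂, h1, h2, h12, -⟩ := hT.split hyT
        exact ⟨S₁, h1, fun h => hv (h12 ▸ Or.inl h)⟩
      · refine ⟨_, hT.join hadj (PathS.refl y) ?_, ?_⟩
        · rintro x hx rfl
          exact hyT hx
        · rintro (h | h)
          · exact hv h
          · exact hyv h.symm
    · rw [h1] at h2
      exact h2 hvR
  · exact ⟨a, Or.inl haR, fun h => h haR⟩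
  · refine ⟨b, fun h => hcon h, ?_⟩
    rintro (h | h)
    · exact hcon h
    · exact hb h

/-- an `A`-`B` path -/
def ABP (G : SimpleGraph V) (A B : Set V) (p q : V) (T : Set V) : Prop :=
  PathS G p q T ∧ p ∈ A ∧ q ∈ B ∧ (∀ x, x ∈ T → x ∈ A → x = p) ∧ (∀ x, x ∈ T → x ∈ B → x = q)

theorem NoSep.abp (hG : NoSep G) (v a b : V) (ha : a ≠ v) (hb : b ≠ v) (A B : Set V)
    (haA : a ∈ A) (hbB : b ∈ B) :
    ∃ p q T, ABP G A B p q T ∧ v ∉ T := by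
  classical
  have hex : ∃ n, ∃ p q T, PathS G p q T ∧ p ∈ A ∧ q ∈ B ∧ v ∉ T ∧ T.ncard = n := by
    obtain ⟨T, hT, hv⟩ := hG.path v a b ha hb
    exact ⟨_, a, b, T, hT, haA, hbB, hv, rfl⟩
  obtain ⟨p, q, T, hT, hp, hq, hv, hn⟩ := Nat.find_spec hex
  have hmin : ∀ p' q' T', PathS G p' q' T' → p' ∈ A → q' ∈ B → T' ⊆ T → T' = T := by
    intro p' q' T' h1 h2 h3 h4
    apply Set.eq_of_subset_of_ncard_le h4 ?_ hT.finite
    rw [hn]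
    exact Nat.find_min' hex ⟨p', q', T', h1, h2, h3, fun h => hv (h4 h), rfl⟩
  refine ⟨p, q, T, ⟨hT, hp, hq, ?_, ?_⟩, hv⟩
  · intro x hx hxA
    obtain ⟨S₁, S₂, h1, h2, h12, hd⟩ := hT.split hx
    have := hmin x q S₂ h2 hxA hq (h12 ▸ Set.subset_union_right)
    exact (hd p h1.left_mem (this ▸ hT.left_mem)).symm
  · intro x hx hxB
    obtain ⟨S₁, S₂, h1, h2, h12, hd⟩ := hT.split hx
    have := hmin p x S₁ h1 hp hxB (h12 ▸ Set.subset_union_left)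
    exact (hd q (this ▸ hT.right_mem) h2.right_mem).symm

/-- two disjoint `A`-`B` paths keeping the ends of a given one -/
theorem NoSep.twoPaths (hG : NoSep G) (B : Set V) (b b' : V) (hb' : b' ∈ B) (hbb' : b' ≠ b) :
    ∀ (n : ℕ) (A : Set V) (a a' : V) (Q : Set V), Q.ncard = n → ABP G A B a b Q →
      a' ∈ A → a' ≠ a →
      ∃ q₁ T₁ p q₂ T₂, ABP G A B a q₁ T₁ ∧ ABP G A B p q₂ T₂ ∧ (∀ x, x ∈ T₁ → x ∉ T₂) ∧
        (q₁ = b ∨ q₂ = b) := by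
  intro n
  induction n with
  | zero =>
    intro A a a' Q hQ hP
    have := (Set.ncard_eq_zero hP.1.finite).1 hQ
    have h2 := hP.1.left_mem
    rw [this] at h2
    exact absurd h2 (by simp)
  | succ n ih =>
    intro A a a' Q hQ hP ha' haa'
    obtain ⟨hQP, haA, hbB, hQA, hQB⟩ := hP
    rcases hQP.uncons with ⟨hab, hQa⟩ | ⟨y, hy, hQ'⟩
    · subst hab
      obtain ⟨p, q, T, hT, hvT⟩ := hG.abp a a' b' haa' hbb' A B ha' hb'
      refine ⟨a, {a}, p, q, T, ⟨PathS.refl a, haA, hbB, ?_, ?_⟩, hT, ?_, Or.inl rfl⟩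
      · intro x hx _; exact hx
      · intro x hx _; exact hx
      · rintro x rfl; exact hvT
    · have hya : y ≠ a := hy.ne'
      have hyQ : y ∈ Q := hQ'.left_mem.1
      have hyA : y ∉ A := fun h => hya (hQA y hyQ h)
      have haB : a ∉ B := by
        intro h
        have := hQB a hQP.left_mem h
        exact hQ'.right_mem.2 this.symm
      obtain ⟨q₁, T₁, p, q₂, T₂, ⟨h11, h12, h13, h14, h15⟩, ⟨h21, h22, h23, h24, h25⟩, hd, hq⟩ :=
        ih (insert y A) y a (Q \ {a}) (by
          rw [Set.ncard_sdiff_singleton_of_mem hQP.left_mem, hQ]; rfl)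
          ⟨hQ', Set.mem_insert _ _, hbB, by
            rintro x ⟨hx, hxa⟩ (hx' | hx')
            · exact hx'
            · exact absurd (hQA x hx hx') hxa, by
            rintro x ⟨hx, hxa⟩ hx'
            exact hQB x hx hx'⟩ (Set.mem_insert_of_mem _ haA) hya.symm
      have hpy : p ≠ y := by
        rintro rfl
        exact hd p h11.left_mem h21.left_mem
      have hpA : p ∈ A := by
        rcases h22 with h | h
        · exact absurd h hpy
        · exact h
      have haT₁ : a ∉ T₁ := fun h => hya (h14 a h (Set.mem_insert_of_mem _ haA)).symm
      have hT₁A : ∀ x, x ∈ T₁ → x ∉ A := by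
        intro x hx hxA
        have := h14 x hx (Set.mem_insert_of_mem _ hxA)
        subst this
        exact hyA hxA
      have hR1 : ABP G A B a q₁ (insert a T₁) := by
        refine ⟨PathS.cons hy h11 haT₁, haA, h13, ?_, ?_⟩
        · rintro x (hx | hx) hxA
          · exact hx
          · exact absurd hxA (hT₁A x hx)
        · rintro x (hx | hx) hxB
          · subst hx; exact absurd hxB haB
          · exact h15 x hx hxB
      have hR2 : ABP G A B p q₂ T₂ :=
        ⟨h21, hpA, h23, fun x hx hxA => h24 x hx (Set.mem_insert_of_mem _ hxA), h25⟩
      by_cases hpa : p = a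
      · subst hpa
        -- reroute
        obtain ⟨z₀, z, Z, ⟨hZ, hz₀, hzD, hZA, hZD⟩, haZ⟩ :=
          hG.abp p a' y haa' hya A (T₁ ∪ T₂ ∪ B) ha' (Or.inl (Or.inl h11.left_mem))
        have hz₀p : z₀ ≠ p := by
          rintro rfl; exact haZ hZ.left_mem
        by_cases hz1 : z ∈ T₁
        · obtain ⟨S₁, S₂, g1, g2, g12, gd⟩ := h11.split hz1
          have hS₂ : ∀ x, x ∈ S₂ → x ∈ T₁ := fun x hx => g12 ▸ Or.inr hx
          refine ⟨q₂, T₂, z₀, q₁, Z ∪ S₂, hR2, ⟨hZ.append g2 ?_, hz₀, h13, ?_, ?_⟩, ?_, hq.symm⟩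
          · intro x hx hx'
            exact hZD x hx (Or.inl (Or.inl (hS₂ x hx')))
          · rintro x (hx | hx) hxA
            · exact hZA x hx hxA
            · exact absurd hxA (hT₁A x (hS₂ x hx))
          · rintro x (hx | hx) hxB
            · have := hZD x hx (Or.inr hxB)
              subst this
              exact h15 x hz1 hxB
            · exact h15 x (hS₂ x hx) hxB
          · rintro x hx (hx' | hx')
            · have := hZD x hx' (Or.inl (Or.inr hx))
              subst this
              exact hd x hz1 hx
            · exact hd x (hS₂ x hx') hx
        · by_cases hz2 : z ∈ T₂
          · obtain ⟨S₁, S₂, g1, g2, g12, gd⟩ := h21.split hz2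
            have hS₂ : ∀ x, x ∈ S₂ → x ∈ T₂ := fun x hx => g12 ▸ Or.inr hx
            have hzp : z ≠ p := by
              rintro rfl; exact haZ hZ.right_mem
            have hpS₂ : p ∉ S₂ := fun h => hzp (gd p g1.left_mem h).symm
            refine ⟨q₁, insert p T₁, z₀, q₂, Z ∪ S₂, hR1,
              ⟨hZ.append g2 ?_, hz₀, h23, ?_, ?_⟩, ?_, hq⟩
            · intro x hx hx'
              exact hZD x hx (Or.inl (Or.inr (hS₂ x hx')))
            · rintro x (hx | hx) hxA
              · exact hZA x hx hxA
              · have := hR2.2.2.2.1 x (hS₂ x hx) hxA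
                subst this
                exact absurd hx hpS₂
            · rintro x (hx | hx) hxB
              · have := hZD x hx (Or.inr hxB)
                subst this
                exact h25 x hz2 hxB
              · exact h25 x (hS₂ x hx) hxB
            · rintro x (hx | hx) (hx' | hx')
              · subst hx; exact haZ hx'
              · subst hx; exact hpS₂ hx'
              · have := hZD x hx' (Or.inl (Or.inl hx))
                subst this
                exact hz1 hx
              · exact hd x hx (hS₂ x hx')
          · have hzB : z ∈ B := by
              rcases hzD with (h | h) | h
              · exact absurd h hz1
              · exact absurd h hz2
              · exact h
            have hZab : ABP G A B z₀ z Z :=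
              ⟨hZ, hz₀, hzB, hZA, fun x hx hxB => hZD x hx (Or.inr hxB)⟩
            rcases hq with hq | hq
            · refine ⟨q₁, insert p T₁, z₀, z, Z, hR1, hZab, ?_, Or.inl hq⟩
              rintro x (hx | hx) hx'
              · subst hx; exact haZ hx'
              · have := hZD x hx' (Or.inl (Or.inl hx))
                subst this
                exact hz1 hx
            · refine ⟨q₂, T₂, z₀, z, Z, hR2, hZab, ?_, Or.inl hq⟩
              rintro x hx hx'
              have := hZD x hx' (Or.inl (Or.inr hx))
              subst this
              exact hz2 hx
      · refine ⟨q₁, insert a T₁, p, q₂, T₂, hR1, hR2, ?_, hq⟩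
        rintro x (hx | hx) hx'
        · subst hx
          exact hpa (h24 x hx' (Set.mem_insert_of_mem _ haA)).symm
        · exact hd x hx hx'


def Seq (G : SimpleGraph V) (x : ℕ → V) (m : ℕ) : Prop :=
  Set.InjOn x (Set.Iic m) ∧ ∀ i < m, G.Adj (x i) (x (i + 1))

theorem Seq.seg {x : ℕ → V} {m : ℕ} (hx : Seq G x m) {i j : ℕ} (hij : i ≤ j) (hj : j ≤ m) :
    PathS G (x i) (x j) (x '' Set.Icc i j) := by
  induction j, hij using Nat.le_induction with
  | base => simpa using PathS.refl (x i)
  | succ j hij ih =>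
    have h1 := (ih (by omega)).join (hx.2 j (by omega)) (PathS.refl (x (j + 1))) (by
      rintro y ⟨l, hl, rfl⟩ h
      have := hx.1 (by simp at hl ⊢; omega) (by simpa using hj) h
      simp at hl; omega)
    have h2 : x '' Set.Icc i j ∪ {x (j + 1)} = x '' Set.Icc i (j + 1) := by
      rw [← Set.image_singleton, ← Set.image_union]
      congr 1
      ext l
      simp only [Set.mem_union, Set.mem_Icc, Set.mem_singleton_iff]
      omega
    rwa [h2] at h1

theorem Seq.rev {x : ℕ → V} {m : ℕ} (hx : Seq G x m) : Seq G (fun i => x (m - i)) m := by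
  refine ⟨?_, ?_⟩
  · intro i hi j hj h
    have := hx.1 (by simp) (by simp) h
    simp at hi hj
    omega
  · intro i hi
    have := hx.2 (m - (i + 1)) (by omega)
    have h2 : m - (i + 1) + 1 = m - i := by omega
    rw [h2] at this
    exact this.symm

theorem Seq.mem_image {x : ℕ → V} {m : ℕ} (hx : Seq G x m) {i : ℕ} (hi : i ≤ m) {I : Set ℕ}
    (hI : I ⊆ Set.Iic m) : x i ∈ x '' I ↔ i ∈ I := by
  constructor
  · rintro ⟨j, hj, h⟩
    have := hx.1 (hI hj) (by simpa using hi) h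
    rwa [← this]
  · exact fun h => ⟨i, h, rfl⟩

/-- The end block path. -/
theorem Seq.endPath {x : ℕ → V} {m : ℕ} (hx : Seq G x m) {a p : ℕ} (ha : a ≤ m) (hpa : p < a)
    (hadj : G.Adj (x 0) (x a)) :
    ∃ I : Set ℕ, I ⊆ Set.Iic a ∧ PathS G (x p) (x a) (x '' I) ∧ 0 ∈ I ∧
      ∀ i ≤ a, G.Adj (x 0) (x i) → i ∈ I := by
  classical
  have hex : ∃ j, p < j ∧ G.Adj (x 0) (x j) := ⟨a, hpa, hadj⟩
  obtain ⟨h1, h2⟩ := Nat.find_spec hex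
  have hja : Nat.find hex ≤ a := Nat.find_min' hex ⟨hpa, hadj⟩
  have hmin : ∀ i, p < i → G.Adj (x 0) (x i) → Nat.find hex ≤ i := fun i h h' =>
    Nat.find_min' hex ⟨h, h'⟩
  generalize Nat.find hex = j at *
  refine ⟨Set.Icc 0 p ∪ Set.Icc j a, ?_, ?_, by simp, ?_⟩
  · intro i; simp; omega
  · rw [Set.image_union]
    refine (hx.seg (Nat.zero_le p) (by omega)).symm.join h2 (hx.seg hja ha) ?_
    rintro y ⟨i, hi, rfl⟩ h
    rw [hx.mem_image (by simp at hi; omega) (by intro i; simp; omega)] at h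
    simp at h hi
    omega
  · intro i hi hi'
    by_cases hip : i ≤ p
    · left; simpa using hip
    · right; exact ⟨hmin i (by omega) hi', hi⟩

theorem Seq.ncard_image {x : ℕ → V} {m : ℕ} (hx : Seq G x m) (I : Finset ℕ)
    (hI : ∀ i ∈ I, i ≤ m) : (x '' (I : Set ℕ)).ncard = I.card := by
  rw [Set.InjOn.ncard_image, Set.ncard_coe_finset]
  exact hx.1.mono (fun i hi => hI i hi)

/-- case of no crossing chords -/
theorem NoSep.noCross (hG : NoSep G) {x : ℕ → V} {m d a b : ℕ} (hx : Seq G x m) (hd : 2 ≤ d)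
    (N0 Nm : Finset ℕ) (hN0 : ∀ i, i ∈ N0 ↔ i ≤ m ∧ G.Adj (x 0) (x i))
    (hNm : ∀ i, i ∈ Nm ↔ i ≤ m ∧ G.Adj (x m) (x i)) (h0 : d ≤ N0.card) (hm : d ≤ Nm.card)
    (ha : a ∈ N0) (ha' : ∀ i ∈ N0, i ≤ a) (hb : b ∈ Nm) (hb' : ∀ i ∈ Nm, b ≤ i) (hab : a ≤ b) :
    HasCycleGE G (2 * d) := by
  classical
  have ham := (hN0 a).1 ha
  have hbm := (hNm b).1 hb
  have hapos : 0 < a := by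
    rcases Nat.eq_zero_or_pos a with h | h
    · exact absurd ham.2 (by rw [h]; exact G.irrefl)
    · exact h
  have hbm' : b < m := by
    rcases Nat.lt_or_ge b m with h | h
    · exact h
    · have : b = m := by omega
      exact absurd hbm.2 (by rw [this]; exact G.irrefl)
  set A : Set V := x '' Set.Iic a with hA
  set B : Set V := x '' Set.Icc b m with hB
  have memA : ∀ i ≤ m, x i ∈ A ↔ i ≤ a := by
    intro i hi
    rw [hA, hx.mem_image hi (by intro i; simp; omega)]; simp
  have memB : ∀ i ≤ m, x i ∈ B ↔ b ≤ i := by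
    intro i hi
    rw [hB, hx.mem_image hi (by intro i; simp)]; simp; omega
  obtain ⟨q₁, T₁, p, q₂, T₂, ⟨h11, h12, h13, h14, h15⟩, ⟨h21, h22, h23, h24, h25⟩, hdis, hq⟩ :=
    hG.twoPaths B (x b) (x m) ((memB m le_rfl).2 hbm'.le)
      (fun h => by have := hx.1 (by simp) (by simpa using hbm.1) h; omega)
      _ A (x a) (x 0) _ rfl
      ⟨hx.seg hab hbm.1, (memA a ham.1).2 le_rfl, (memB b hbm.1).2 le_rfl, by
        rintro y ⟨i, hi, rfl⟩ hy
        simp at hi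
        have := (memA i (by omega)).1 hy
        congr 1; omega, by
        rintro y ⟨i, hi, rfl⟩ hy
        simp at hi
        have := (memB i (by omega)).1 hy
        congr 1; omega⟩ ((memA 0 (by omega)).2 (by omega))
      (fun h => by have := hx.1 (by simp) (by simpa using ham.1) h; omega)
  -- the A-part
  obtain ⟨pi, hpi, rfl⟩ := h22
  have hpi' : pi < a := by
    rcases Nat.lt_or_ge pi a with h | h
    · exact h
    · have : pi = a := by simp at hpi; omega
      subst this
      exact absurd h21.left_mem (hdis _ h11.left_mem)
  obtain ⟨I, hI1, hI2, hI3, hI4⟩ := hx.endPath ham.1 hpi' ham.2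
  -- the B-part
  have hBpart : ∀ qi, b < qi → qi ≤ m → ∃ J : Set ℕ, J ⊆ Set.Icc b m ∧
      PathS G (x qi) (x b) (x '' J) ∧ m ∈ J ∧ ∀ i ≤ m, G.Adj (x m) (x i) → i ∈ J := by
    intro qi h1 h2
    obtain ⟨J, hJ1, hJ2, hJ3, hJ4⟩ := hx.rev.endPath (a := m - b) (p := m - qi) (by omega)
      (by omega) (by
        have : m - (m - b) = b := by omega
        simpa [this] using hbm.2)
    refine ⟨(fun i => m - i) '' J, ?_, ?_, ?_, ?_⟩
    · rintro _ ⟨i, hi, rfl⟩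
      have := hJ1 hi
      simp at this ⊢
      omega
    · rw [Set.image_image]
      have e1 : m - (m - b) = b := by omega
      have e2 : m - (m - qi) = qi := by omega
      simpa only [e1, e2] using hJ2
    · exact ⟨0, hJ3, by simp⟩
    · intro i hi hadj
      have hbi := hb' i ((hNm i).2 ⟨hi, hadj⟩)
      refine ⟨m - i, hJ4 (m - i) (by omega) ?_, by simp; omega⟩
      have e1 : m - (m - i) = i := by omega
      simpa [e1] using hadj
  have hB2 : ∃ J : Set ℕ, J ⊆ Set.Icc b m ∧
      PathS G q₁ q₂ (x '' J) ∧ m ∈ J ∧ ∀ i ≤ m, G.Adj (x m) (x i) → i ∈ J := by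
    have hne : q₁ ≠ q₂ := by
      rintro rfl
      exact hdis _ h11.right_mem h21.right_mem
    obtain ⟨i1, hi1, rfl⟩ := h13
    obtain ⟨i2, hi2, rfl⟩ := h23
    simp at hi1 hi2
    rcases hq with hq | hq
    · have : i1 = b := hx.1 (by simpa using hi1.2) (by simpa using hbm.1) hq
      subst this
      obtain ⟨J, hJ1, hJ2, hJ3⟩ := hBpart i2 (by
        rcases Nat.lt_or_ge i1 i2 with h | h
        · exact h
        · exact absurd (by congr 1; omega) hne) hi2.2
      exact ⟨J, hJ1, hJ2.symm, hJ3⟩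
    · have : i2 = b := hx.1 (by simpa using hi2.2) (by simpa using hbm.1) hq
      subst this
      exact hBpart i1 (by
        rcases Nat.lt_or_ge i2 i1 with h | h
        · exact h
        · exact absurd (by congr 1; omega) hne) hi1.2
  obtain ⟨J, hJ1, hJ2, hJ3, hJ4⟩ := hB2
  have hIA : x '' I ⊆ A := Set.image_mono hI1
  have hJB : x '' J ⊆ B := Set.image_mono hJ1
  have hAB : ∀ y, y ∈ A → y ∈ B → y = x a := by
    rintro y ⟨i, hi, rfl⟩ hy
    simp at hi
    have := (memB i (by omega)).1 hy
    congr 1; omega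
  have hP1 := hI2.append h11 (fun y hy hy' => h14 y hy' (hIA hy))
  have hP2 := hP1.append hJ2 (by
    rintro y (hy | hy) hy'
    · have e := hAB y (hIA hy) (hJB hy')
      subst e
      exact h15 _ h11.left_mem (hJB hy')
    · exact h15 y hy (hJB hy'))
  have hne : x pi ≠ q₂ := by
    intro h
    have := hAB (x pi) ((memA pi (by omega)).2 hpi'.le) (h ▸ h23)
    have := hx.1 (by simp; omega) (by simpa using ham.1) this
    omega
  have hsub : x '' (((insert 0 (N0.erase a)) ∪ (insert m Nm) : Finset ℕ) : Set ℕ) ⊆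
      x '' I ∪ T₁ ∪ x '' J ∪ T₂ := by
    rintro _ ⟨i, hi, rfl⟩
    simp only [Finset.coe_union, Finset.coe_insert, Set.mem_union, Set.mem_insert_iff,
      Finset.mem_coe, Finset.mem_erase] at hi
    rcases hi with (rfl | ⟨-, hi⟩) | (rfl | hi)
    · exact Or.inl (Or.inl (Or.inl ⟨_, hI3, rfl⟩))
    · exact Or.inl (Or.inl (Or.inl ⟨_, hI4 i (ha' i hi) ((hN0 i).1 hi).2, rfl⟩))
    · exact Or.inl (Or.inr ⟨_, hJ3, rfl⟩)
    · exact Or.inl (Or.inr ⟨_, hJ4 i ((hNm i).1 hi).1 ((hNm i).1 hi).2, rfl⟩)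
  have hcard : 2 * d ≤ ((insert 0 (N0.erase a)) ∪ (insert m Nm) : Finset ℕ).card := by
    rw [Finset.card_union_of_disjoint, Finset.card_insert_of_notMem, Finset.card_insert_of_notMem,
      Finset.card_erase_of_mem ha]
    · omega
    · rw [hNm]; simp
    · rw [Finset.mem_erase, hN0]; simp
    · rw [Finset.disjoint_left]
      intro i hi hi'
      rw [Finset.mem_insert, Finset.mem_erase] at hi
      rw [Finset.mem_insert] at hi'
      have h1 : i < a := by
        rcases hi with rfl | ⟨h, h'⟩
        · exact hapos
        · have := ha' i h'; omega
      rcases hi' with rfl | h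
      · omega
      · have := hb' i h; omega
  have hfin : (x '' I ∪ T₁ ∪ x '' J ∪ T₂).Finite :=
    Set.Finite.union hP2.finite h21.finite
  have hge : 2 * d ≤ (x '' I ∪ T₁ ∪ x '' J ∪ T₂).ncard := by
    refine le_trans hcard ?_
    rw [← hx.ncard_image _ (by
      intro i hi
      simp only [Finset.mem_union, Finset.mem_insert, Finset.mem_erase] at hi
      rcases hi with (rfl | ⟨-, hi⟩) | (rfl | hi)
      · omega
      · exact ((hN0 i).1 hi).1
      · omega
      · exact ((hNm i).1 hi).1)]
    exact Set.ncard_le_ncard hsub hfin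
  obtain ⟨v, w, hw, hl⟩ := hP2.cycle₂ h21 hne (by
    rintro y ((hy | hy) | hy) hy'
    · exact Or.inl (h24 y hy' (hIA hy))
    · exact absurd hy' (hdis y hy)
    · exact Or.inr (h25 y hy' (hJB hy))) (by omega)
  exact ⟨v, w, hw, by omega⟩


theorem PathS.seq {u v : V} {S : Set V} (h : PathS G u v S) :
    ∃ (x : ℕ → V) (m : ℕ), Seq G x m ∧ x 0 = u ∧ x m = v ∧ x '' Set.Iic m = S := by
  obtain ⟨p, hp, rfl⟩ := h
  refine ⟨p.getVert, p.length, ⟨?_, ?_⟩, by simp, by simp, ?_⟩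
  · exact hp.getVert_injOn
  · intro i hi
    exact p.adj_getVert_succ hi
  · ext y
    simp only [Set.mem_image, Set.mem_Iic]
    constructor
    · rintro ⟨i, -, rfl⟩
      exact p.getVert_mem_support i
    · intro hy
      obtain ⟨n, h1, h2⟩ := Walk.mem_support_iff_exists_getVert.1 hy
      exact ⟨n, h2, h1⟩

/-- The Dirac theorem on long cycles in 2-connected graphs. -/
theorem NoSep.dirac [Fintype V] (hG : NoSep G) {d : ℕ} (hd : 2 ≤ d)
    (hdeg : ∀ v, d ≤ {w | G.Adj v w}.ncard) (hcard : 2 * d ≤ Fintype.card V) :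
    HasCycleGE G (2 * d) := by
  classical
  -- a longest path
  have hex : ∃ n, ∃ u v S, PathS G u v S ∧ S.ncard = n := by
    have : 0 < Fintype.card V := by omega
    obtain ⟨v⟩ := Fintype.card_pos_iff.1 this
    exact ⟨_, v, v, {v}, PathS.refl v, rfl⟩
  have hbd : ∀ n, (∃ u v S, PathS G u v S ∧ S.ncard = n) → n ≤ Fintype.card V := by
    rintro n ⟨u, v, S, -, rfl⟩
    rw [← Nat.card_eq_fintype_card, ← Set.ncard_univ]
    exact Set.ncard_le_ncard (Set.subset_univ S)
  obtain ⟨n, ⟨u, v, S, hS, hn⟩, hmaxn⟩ : ∃ n, (∃ u v S, PathS G u v S ∧ S.ncard = n) ∧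
      ∀ n', (∃ u v S, PathS G u v S ∧ S.ncard = n') → n' ≤ n := by
    obtain ⟨n0, hn0⟩ := hex
    refine ⟨Nat.findGreatest (fun n => ∃ u v S, PathS G u v S ∧ S.ncard = n) (Fintype.card V),
      ?_, ?_⟩
    · exact Nat.findGreatest_spec (P := fun n => ∃ u v S, PathS G u v S ∧ S.ncard = n)
        (hbd n0 hn0) hn0
    · intro n' hn'
      exact Nat.le_findGreatest (hbd n' hn') hn'
  obtain ⟨x, m, hx, hx0, hxm, hxS⟩ := hS.seq
  have hmn : n = m + 1 := by
    rw [← hn, ← hxS, Set.InjOn.ncard_image hx.1, ← Finset.coe_Iic, Set.ncard_coe_finset]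
    simp
  have hmax : ∀ u' v' S', PathS G u' v' S' → S'.ncard ≤ S.ncard := by
    intro u' v' S' h
    rw [hn]
    exact hmaxn _ ⟨u', v', S', h, rfl⟩
  -- all neighbours of the ends are on the path
  have hends : ∀ u' v', PathS G u' v' S → ∀ y, G.Adj u' y → y ∈ S := by
    intro u' v' hP y hy
    by_contra hyS
    have := hmax _ _ _ (PathS.cons hy.symm hP hyS)
    rw [Set.ncard_insert_of_notMem hyS hP.finite] at this
    omega
  set N0 : Finset ℕ := (Finset.range (m + 1)).filter (fun i => G.Adj (x 0) (x i)) with hN0d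
  set Nm : Finset ℕ := (Finset.range (m + 1)).filter (fun i => G.Adj (x m) (x i)) with hNmd
  have hN0 : ∀ i, i ∈ N0 ↔ i ≤ m ∧ G.Adj (x 0) (x i) := by
    intro i; rw [hN0d, Finset.mem_filter, Finset.mem_range, Nat.lt_succ_iff]
  have hNm : ∀ i, i ∈ Nm ↔ i ≤ m ∧ G.Adj (x m) (x i) := by
    intro i; rw [hNmd, Finset.mem_filter, Finset.mem_range, Nat.lt_succ_iff]
  have hc0 : d ≤ N0.card := by
    refine le_trans (hdeg (x 0)) ?_
    rw [← hx.ncard_image N0 (fun i hi => ((hN0 i).1 hi).1)]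
    refine Set.ncard_le_ncard ?_ (Set.toFinite _)
    intro y hy
    have h1 : y ∈ S := hends u v hS y (hx0 ▸ hy)
    rw [← hxS] at h1
    obtain ⟨i, hi, rfl⟩ := h1
    exact ⟨i, (hN0 i).2 ⟨hi, hy⟩, rfl⟩
  have hcm : d ≤ Nm.card := by
    refine le_trans (hdeg (x m)) ?_
    rw [← hx.ncard_image Nm (fun i hi => ((hNm i).1 hi).1)]
    refine Set.ncard_le_ncard ?_ (Set.toFinite _)
    intro y hy
    have h1 : y ∈ S := hends v u hS.symm y (hxm ▸ hy)
    rw [← hxS] at h1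
    obtain ⟨i, hi, rfl⟩ := h1
    exact ⟨i, (hNm i).2 ⟨hi, hy⟩, rfl⟩
  -- crossing chords give a cycle
  have hcross : ∀ i j, i < j → i ∈ Nm → j ∈ N0 →
      PathS G (x 0) (x j) (x '' ((Finset.Icc 0 i ∪ Finset.Icc j m : Finset ℕ) : Set ℕ)) := by
    intro i j hij hi hj
    have hj' := ((hN0 j).1 hj).1
    rw [Finset.coe_union, Finset.coe_Icc, Finset.coe_Icc, Set.image_union]
    refine (hx.seg (Nat.zero_le i) (by omega)).join ((hNm i).1 hi).2.symm
      (hx.seg hj' le_rfl).symm ?_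
    rintro y ⟨l, hl, rfl⟩ h
    rw [hx.mem_image (by simp at hl; omega) (by intro i; simp)] at h
    simp at h hl
    omega
  have hcyc : ∀ i j, i < j → i ∈ Nm → j ∈ N0 →
      2 * d ≤ (Finset.Icc 0 i ∪ Finset.Icc j m : Finset ℕ).card → HasCycleGE G (2 * d) := by
    intro i j hij hi hj hc
    have hP := hcross i j hij hi hj
    have hnc := hx.ncard_image (Finset.Icc 0 i ∪ Finset.Icc j m) (by
      intro l hl
      have hj' := ((hN0 j).1 hj).1
      simp at hl; omega)
    obtain ⟨v, w, hw, hl⟩ := hP.cycle ((hN0 j).1 hj).2.symm (by omega)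
    exact ⟨v, w, hw, by omega⟩
  by_cases hcase : ∃ g, ∃ i j, i < j ∧ i ∈ Nm ∧ j ∈ N0 ∧ j - i = g
  · obtain ⟨i, j, hij, hi, hj, hg⟩ := Nat.find_spec hcase
    have hmin : ∀ i' j', i' < j' → i' ∈ Nm → j' ∈ N0 → j - i ≤ j' - i' := by
      intro i' j' h1 h2 h3
      rw [hg]
      exact Nat.find_min' hcase ⟨i', j', h1, h2, h3, rfl⟩
    have hjm := ((hN0 j).1 hj).1
    by_cases hadj : j = i + 1
    · by_cases hbig : 2 * d ≤ m + 1
      · refine hcyc i j hij hi hj ?_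
        have : Finset.Icc 0 i ∪ Finset.Icc j m = Finset.range (m + 1) := by
          ext l; simp; omega
        rw [this, Finset.card_range]
        exact hbig
      · -- extend the path
        exfalso
        have hP := hcross i j hij hi hj
        have : (Finset.Icc 0 i ∪ Finset.Icc j m : Finset ℕ) = Finset.Iic m := by
          ext l; simp; omega
        rw [this, Finset.coe_Iic, hxS] at hP
        have hrot := fun z hz => hP.rotate ((hN0 j).1 hj).2.symm (z := z) hz
        have hout : (Sᶜ : Set V).Nonempty := by
          rw [Set.nonempty_compl]
          intro h
          rw [h, Set.ncard_univ, Nat.card_eq_fintype_card] at hn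
          omega
        refine hG u S Sᶜ (Set.union_compl_self S) (by simp) ?_ ?_ ?_
        · rintro z ⟨hz, -⟩ y ⟨hy, -⟩ hzy
          obtain ⟨z', hz'⟩ := hrot z hz
          exact hy (hends z z' hz' y hzy)
        · exact ⟨u, hS.left_mem, fun h => h hS.left_mem⟩
        · obtain ⟨y, hy⟩ := hout
          exact ⟨y, hy, hy⟩
    · refine hcyc i j hij hi hj ?_
      -- count
      have hno : ∀ l ∈ N0, l ≠ 0 ∧ l - 1 ∉ Nm := by
        intro l hl
        have hl0 : l ≠ 0 := by
          rintro rfl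
          exact G.irrefl ((hN0 0).1 hl).2
        refine ⟨hl0, fun h => ?_⟩
        have := hmin (l - 1) l (by omega) h hl
        omega
      have hgap : ∀ l, i < l → l < j → l ∉ N0 ∧ l ∉ Nm := by
        intro l h1 h2
        constructor
        · intro h
          have := hmin i l h1 hi h
          omega
        · intro h
          have := hmin l j h2 h hj
          omega
      have hsub : (insert m Nm) ∪ (N0.erase j).image (fun l => l - 1) ⊆
          Finset.Icc 0 i ∪ Finset.Icc j m := by
        intro l hl
        rw [Finset.mem_union, Finset.mem_insert, Finset.mem_image] at hl
        rw [Finset.mem_union, Finset.mem_Icc, Finset.mem_Icc]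
        rcases hl with (rfl | hl) | ⟨l', hl', rfl⟩
        · omega
        · have h1 := ((hNm l).1 hl).1
          by_contra hcon
          exact (hgap l (by omega) (by omega)).2 hl
        · rw [Finset.mem_erase] at hl'
          have h1 := ((hN0 l').1 hl'.2).1
          have h2 := (hno l' hl'.2).1
          by_contra hcon
          exact (hgap l' (by omega) (by omega)).1 hl'.2
      refine le_trans ?_ (Finset.card_le_card hsub)
      rw [Finset.card_union_of_disjoint, Finset.card_insert_of_notMem, Finset.card_image_of_injOn,
        Finset.card_erase_of_mem hj]
      · omega
      · intro l hl l' hl' h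
        have h1 := (hno l (Finset.mem_of_mem_erase hl)).1
        have h2 := (hno l' (Finset.mem_of_mem_erase hl')).1
        simp only at h
        omega
      · rw [hNm]; simp
      · rw [Finset.disjoint_left]
        intro l hl hl'
        rw [Finset.mem_image] at hl'
        obtain ⟨l', hl', rfl⟩ := hl'
        have h3 := Finset.mem_of_mem_erase hl'
        have h1 := hno l' h3
        have h2 := ((hN0 l').1 h3).1
        rw [Finset.mem_insert] at hl
        rcases hl with h | h
        · omega
        · exact h1.2 h
  · have hne0 : N0.Nonempty := Finset.card_pos.1 (by omega)
    have hnem : Nm.Nonempty := Finset.card_pos.1 (by omega)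
    refine hG.noCross hx hd N0 Nm hN0 hNm hc0 hcm (N0.max'_mem hne0) (fun i hi => N0.le_max' i hi)
      (Nm.min'_mem hnem) (fun i hi => Nm.min'_le i hi) ?_
    by_contra hcon
    exact hcase ⟨_, _, _, not_le.1 hcon, Nm.min'_mem hnem, N0.max'_mem hne0, rfl⟩


open Classical in
/-- twice the number of edges inside `S` -/
noncomputable def dsum (G : SimpleGraph V) (S : Finset V) : ℕ :=
  ((S ×ˢ S).filter (fun e => G.Adj e.1 e.2)).card

theorem dsum_le_of_sep (G : SimpleGraph V) (S X Y : Finset V)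
    (h : ∀ u ∈ S, ∀ v ∈ S, G.Adj u v → (u ∈ X ∧ v ∈ X) ∨ (u ∈ Y ∧ v ∈ Y)) :
    dsum G S ≤ dsum G X + dsum G Y := by
  classical
  unfold dsum
  refine le_trans (Finset.card_le_card ?_) (Finset.card_union_le _ _)
  rintro ⟨u, v⟩ he
  simp only [Finset.mem_filter, Finset.mem_product, Finset.mem_union] at he ⊢
  rcases h u he.1.1 v he.1.2 he.2 with h | h
  · exact Or.inl ⟨h, he.2⟩
  · exact Or.inr ⟨h, he.2⟩

open Classical in
theorem dsum_le_erase (G : SimpleGraph V) (S : Finset V) (v : V) :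
    dsum G S ≤ dsum G (S.erase v) + 2 * (S.filter (fun w => G.Adj v w)).card := by
  unfold dsum
  set N := S.filter (fun w => G.Adj v w) with hN
  have hsub : (S ×ˢ S).filter (fun e => G.Adj e.1 e.2) ⊆
      ((S.erase v) ×ˢ (S.erase v)).filter (fun e => G.Adj e.1 e.2) ∪
        (N.image (fun w => (v, w)) ∪ N.image (fun w => (w, v))) := by
    rintro ⟨a, b⟩ he
    simp only [hN, Finset.mem_filter, Finset.mem_product, Finset.mem_union, Finset.mem_erase,
      Finset.mem_image, Prod.mk.injEq] at he ⊢
    by_cases ha : a = v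
    · subst ha
      exact Or.inr (Or.inl ⟨b, ⟨he.1.2, he.2⟩, rfl, rfl⟩)
    · by_cases hb : b = v
      · subst hb
        exact Or.inr (Or.inr ⟨a, ⟨he.1.1, he.2.symm⟩, rfl, rfl⟩)
      · exact Or.inl ⟨⟨⟨ha, he.1.1⟩, hb, he.1.2⟩, he.2⟩
  have h1 := Finset.card_le_card hsub
  have h2 := Finset.card_union_le
    (((S.erase v) ×ˢ (S.erase v)).filter (fun e => G.Adj e.1 e.2))
    (N.image (fun w => (v, w)) ∪ N.image (fun w => (w, v)))
  have h3 := Finset.card_union_le (N.image (fun w => (v, w))) (N.image (fun w => (w, v)))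
  have h4 : (N.image (fun w => (v, w))).card ≤ N.card := Finset.card_image_le
  have h5 : (N.image (fun w => (w, v))).card ≤ N.card := Finset.card_image_le
  omega

theorem dsum_add_card_le (G : SimpleGraph V) (S : Finset V) :
    dsum G S + S.card ≤ S.card * S.card := by
  classical
  have h1 : dsum G S ≤ S.offDiag.card := by
    unfold dsum
    refine Finset.card_le_card ?_
    rintro ⟨a, b⟩ he
    simp only [Finset.mem_filter, Finset.mem_product, Finset.mem_offDiag] at he ⊢
    exact ⟨he.1.1, he.1.2, he.2.ne⟩
  rw [Finset.offDiag_card] at h1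
  have : S.card ≤ S.card * S.card := Nat.le_mul_self _
  omega

theorem hasCycleGE_of_induce {S : Set V} {k : ℕ} (h : HasCycleGE (G.induce S) k) :
    HasCycleGE G k := by
  obtain ⟨v, w, hw, hl⟩ := h
  refine ⟨_, w.map (Embedding.induce S).toHom, ?_, ?_⟩
  · exact hw.map (Embedding.induce (G := G) S).injective
  · exact hl.trans (Walk.length_map _ w).ge

theorem dsum_bound (G : SimpleGraph V) (t : ℕ) (ht : 2 ≤ t) (hcyc : ¬ HasCycleGE G (2 * t + 2))
    (hsm : ∀ S : Finset V, S.card = 2 * t + 1 → dsum G S ≤ 4 * t * t) :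
    ∀ S : Finset V, S.Nonempty → dsum G S + 2 * t ≤ 2 * t * S.card := by
  classical
  intro S
  induction S using Finset.strongInduction with
  | H S ih =>
  intro hS
  have hpos := hS.card_pos
  rcases Nat.lt_or_ge S.card (2 * t + 2) with hlt | hge
  · by_cases heq : S.card = 2 * t + 1
    · have := hsm S heq
      rw [heq]
      nlinarith
    · have h1 := dsum_add_card_le G S
      have h2 : S.card ≤ 2 * t := by omega
      generalize S.card = s at *
      obtain ⟨r, rfl⟩ : ∃ r, s = r + 1 := ⟨s - 1, by omega⟩
      nlinarith
  by_contra hcon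
  push Not at hcon
  apply hcyc
  have hdeg : ∀ v ∈ S, t + 1 ≤ (S.filter (fun w => G.Adj v w)).card := by
    intro v hv
    by_contra hlt
    have h1 := dsum_le_erase G S v
    have hc := Finset.card_erase_of_mem hv
    have h2 := ih (S.erase v) (Finset.erase_ssubset hv) (Finset.card_pos.1 (by omega))
    rw [hc] at h2
    obtain ⟨r, hr⟩ : ∃ r, S.card = r + 1 := ⟨S.card - 1, by omega⟩
    rw [hr] at h2 hcon
    simp only [Nat.add_sub_cancel] at h2
    nlinarith
  have hsep : NoSep (G.induce (S : Set V)) := by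
    intro v X Y hXY hXYv hno hX hY
    set X' := S.filter (fun u => ∃ h : u ∈ (S : Set V), (⟨u, h⟩ : (S : Set V)) ∈ X) with hX'
    set Y' := S.filter (fun u => ∃ h : u ∈ (S : Set V), (⟨u, h⟩ : (S : Set V)) ∈ Y) with hY'
    have mX : ∀ u : (S : Set V), (u : V) ∈ X' ↔ u ∈ X := by
      intro u
      rw [hX', Finset.mem_filter]
      exact ⟨fun h => h.2.2, fun h => ⟨u.2, u.2, h⟩⟩
    have mY : ∀ u : (S : Set V), (u : V) ∈ Y' ↔ u ∈ Y := by
      intro u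
      rw [hY', Finset.mem_filter]
      exact ⟨fun h => h.2.2, fun h => ⟨u.2, u.2, h⟩⟩
    obtain ⟨a, haX, haY⟩ := hX
    obtain ⟨b, hbY, hbX⟩ := hY
    have hXs : X' ⊂ S := by
      refine Finset.ssubset_iff_subset_ne.2 ⟨Finset.filter_subset _ _, fun h => hbX ?_⟩
      rw [← mX, h]; exact b.2
    have hYs : Y' ⊂ S := by
      refine Finset.ssubset_iff_subset_ne.2 ⟨Finset.filter_subset _ _, fun h => haY ?_⟩
      rw [← mY, h]; exact a.2
    have h1 := ih X' hXs ⟨a, (mX a).2 haX⟩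
    have h2 := ih Y' hYs ⟨b, (mY b).2 hbY⟩
    have h3 : dsum G S ≤ dsum G X' + dsum G Y' := by
      apply dsum_le_of_sep
      intro u hu w hw huw
      have hu1 : (⟨u, hu⟩ : (S : Set V)) ∈ X ∪ Y := hXY ▸ Set.mem_univ _
      have hw1 : (⟨w, hw⟩ : (S : Set V)) ∈ X ∪ Y := hXY ▸ Set.mem_univ _
      have k1 := hno ⟨u, hu⟩
      have k2 := hno ⟨w, hw⟩
      have k3 := mX ⟨u, hu⟩
      have k4 := mX ⟨w, hw⟩
      have k5 := mY ⟨u, hu⟩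
      have k6 := mY ⟨w, hw⟩
      have a1 : (G.induce (S : Set V)).Adj ⟨u, hu⟩ ⟨w, hw⟩ := huw
      have a2 := a1.symm
      simp only at k3 k4 k5 k6
      rw [k3, k4, k5, k6]
      simp only [Set.mem_union] at hu1 hw1
      by_contra hcc
      by_cases hux : (⟨u, hu⟩ : (S : Set V)) ∈ X
      · have hwx : (⟨w, hw⟩ : (S : Set V)) ∉ X := fun h => hcc (Or.inl ⟨hux, h⟩)
        have hwy := hw1.resolve_left hwx
        have huy : (⟨u, hu⟩ : (S : Set V)) ∉ Y := fun h => hcc (Or.inr ⟨h, hwy⟩)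
        exact k1 ⟨hux, huy⟩ _ ⟨hwy, hwx⟩ a1
      · have huy := hu1.resolve_left hux
        have hwy : (⟨w, hw⟩ : (S : Set V)) ∉ Y := fun h => hcc (Or.inr ⟨huy, h⟩)
        exact k2 ⟨hw1.resolve_right hwy, hwy⟩ _ ⟨huy, hux⟩ a2
    have h4 : X'.card + Y'.card ≤ S.card + 1 := by
      rw [← Finset.card_union_add_card_inter]
      have h5 : (X' ∪ Y').card ≤ S.card :=
        Finset.card_le_card (Finset.union_subset hXs.1 hYs.1)
      have h6 : (X' ∩ Y').card ≤ 1 := by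
        have : Nonempty V := ⟨a⟩
        rw [Finset.card_le_one_iff_subset_singleton]
        · refine ⟨v, ?_⟩
          intro u hu
          rw [Finset.mem_inter] at hu
          have huS := hXs.1 hu.1
          have := hXYv ⟨(mX ⟨u, huS⟩).1 hu.1, (mY ⟨u, huS⟩).1 hu.2⟩
          rw [Finset.mem_singleton]
          exact congrArg Subtype.val this
      omega
    nlinarith
  have hfin := hsep.dirac (d := t + 1) (by omega) (by
    intro v
    refine le_trans (hdeg v v.2) ?_
    rw [← Set.ncard_image_of_injective _ Subtype.val_injective, ← Set.ncard_coe_finset]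
    refine Set.ncard_le_ncard ?_ (Set.toFinite _)
    intro w hw
    rw [Finset.mem_coe, Finset.mem_filter] at hw
    exact ⟨⟨w, hw.1⟩, hw.2, rfl⟩) (by simp; omega)
  exact hasCycleGE_of_induce hfin

theorem two_mul_edgeCount [Fintype V] (G : SimpleGraph V) :
    2 * edgeCount G = dsum G Finset.univ := by
  classical
  unfold edgeCount dsum
  rw [Set.ncard_eq_toFinset_card']
  have := G.two_mul_card_edgeFinset
  rw [edgeFinset] at this
  rw [this]
  congr 1

theorem exMax_bdd (n : ℕ) (P : SimpleGraph (Fin n) → Prop) :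
    BddAbove {m | ∃ G : SimpleGraph (Fin n), P G ∧ edgeCount G = m} := by
  refine ⟨n * n, ?_⟩
  rintro m ⟨G, -, rfl⟩
  have h1 := two_mul_edgeCount G
  have h2 := dsum_add_card_le G Finset.univ
  simp only [Finset.card_univ, Fintype.card_fin] at h2
  omega

/-- complete bipartite graph `K_{t,n-t}` -/
def kb (t n : ℕ) : SimpleGraph (Fin n) where
  Adj i j := ¬ ((i : ℕ) < t ↔ (j : ℕ) < t)
  symm := ⟨fun _ _ h h' => h h'.symm⟩
  loopless := ⟨fun _ h => h Iff.rfl⟩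

theorem kb_edges (t n : ℕ) (h : t ≤ n) : t * (n - t) ≤ edgeCount (kb t n) := by
  classical
  have h1 := two_mul_edgeCount (kb t n)
  set T : Finset (Fin n) := Finset.univ.filter (fun i => (i : ℕ) < t) with hT
  have hTc : T.card = t := by
    rw [hT, Fin.card_filter_val_lt]; omega
  have hTc' : Tᶜ.card = n - t := by
    rw [Finset.card_compl, hTc, Fintype.card_fin]
  have h2 : (T ×ˢ Tᶜ ∪ Tᶜ ×ˢ T).card ≤ dsum (kb t n) Finset.univ := by
    unfold dsum
    refine Finset.card_le_card ?_
    rintro ⟨a, b⟩ hab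
    simp only [hT, Finset.mem_union, Finset.mem_product, Finset.mem_compl, Finset.mem_filter,
      Finset.mem_univ, true_and] at hab ⊢
    show ¬ _
    tauto
  rw [Finset.card_union_of_disjoint, Finset.card_product, Finset.card_product, hTc, hTc'] at h2
  · nlinarith
  · rw [Finset.disjoint_left]
    rintro ⟨a, b⟩ h1 h2
    simp only [Finset.mem_product, Finset.mem_compl] at h1 h2
    exact h2.1 h1.1

theorem kb_cycle (t n : ℕ) : ¬ HasCycleGE (kb t n) (2 * t + 2) := by
  classical
  rintro ⟨v, w, hw, hl⟩
  set f : ℕ → ℕ := fun i => if (w.getVert (2 * i) : ℕ) < t then 2 * i else 2 * i + 1 with hf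
  have hf2 : ∀ i, f i = 2 * i ∨ f i = 2 * i + 1 := by
    intro i; simp only [hf]; split_ifs <;> simp
  have hfT : ∀ i, i ≤ t → (w.getVert (f i) : ℕ) < t := by
    intro i hi
    simp only [hf]
    split_ifs with h
    · exact h
    · have : ¬ _ := w.adj_getVert_succ (i := 2 * i) (by omega)
      by_contra hc
      exact this ⟨fun h' => absurd h' h, fun h' => absurd h' hc⟩
  have := Finset.exists_ne_map_eq_of_card_lt_of_maps_to (s := Finset.range (t + 1))
    (t := Finset.range t) (by simp) (f := fun i => (w.getVert (f i) : ℕ)) (by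
      intro i hi
      have := hfT i (by simp at hi; omega)
      simpa using this)
  obtain ⟨i, hi, j, hj, hij, he⟩ := this
  have h2 := hw.getVert_injOn' (by
      have := hf2 i
      simp at hi ⊢; omega) (by
      have := hf2 j
      simp at hj ⊢; omega) (Fin.ext he)
  have := hf2 i
  have := hf2 j
  omega

theorem kb_free {α : Type*} [Fintype α] (F : SimpleGraph α) (t n : ℕ) (hF : PGE F (t + 1)) :
    ¬ ContainsCopy F (kb t n) := by
  classical
  rintro ⟨f, hf, hadj⟩
  have h := (hF (fun a => decide ((f a : ℕ) < t)) (by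
    intro a b hab h
    have h1 : ¬ _ := hadj hab
    exact h1 (by simpa using h))).1
  have h2 : {a | decide ((f a : ℕ) < t) = true}.ncard ≤ ((Finset.range t : Finset ℕ) : Set ℕ).ncard := by
    refine Set.ncard_le_ncard_of_injOn (fun a => (f a : ℕ)) ?_ ?_ (Set.toFinite _)
    · intro a ha
      simpa using ha
    · intro a _ b _ hab
      exact hf (Fin.ext hab)
  rw [Set.ncard_coe_finset, Finset.card_range] at h2
  omega

theorem upper {α : Type*} (F : SimpleGraph α) (t n : ℕ) (ht : 2 ≤ t)
    (hs : exMax (2 * t + 1) (fun G => ¬ ContainsCopy F G) ≤ 2 * t * t)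
    (G : SimpleGraph (Fin n)) (hc : ¬ HasCycleGE G (2 * t + 2)) (hF : ¬ ContainsCopy F G) :
    edgeCount G ≤ t * n := by
  classical
  rcases Nat.eq_zero_or_pos n with hn | hn
  · subst hn
    have h1 := two_mul_edgeCount G
    have h2 := dsum_add_card_le G Finset.univ
    have h3 : (Finset.univ : Finset (Fin 0)).card = 0 := by simp
    rw [h3] at h2
    omega
  have h1 := dsum_bound G t ht hc (by
    intro S hS
    set e : Fin (2 * t + 1) ≃ S := (S.equivFinOfCardEq hS).symm
    set H : SimpleGraph (Fin (2 * t + 1)) := G.comap (fun i => (e i : Fin n)) with hH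
    have hHF : ¬ ContainsCopy F H := by
      rintro ⟨f, hf, hadj⟩
      exact hF ⟨fun a => (e (f a) : Fin n),
        Subtype.val_injective.comp (e.injective.comp hf), fun a b hab => hadj hab⟩
    have h2 : edgeCount H ≤ 2 * t * t :=
      le_trans (le_csSup (exMax_bdd _ _) ⟨H, hHF, rfl⟩) hs
    have h3 := two_mul_edgeCount H
    have h4 : dsum G S ≤ dsum H Finset.univ := by
      unfold dsum
      refine le_trans (Finset.card_le_card ?_)
        (Finset.card_image_le (f := fun x : Fin (2 * t + 1) × Fin (2 * t + 1) =>
          ((e x.1 : Fin n), (e x.2 : Fin n))))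
      rintro ⟨a, b⟩ hab
      simp only [Finset.mem_filter, Finset.mem_product] at hab
      rw [Finset.mem_image]
      refine ⟨(e.symm ⟨a, hab.1.1⟩, e.symm ⟨b, hab.1.2⟩), ?_, by simp⟩
      simpa [hH] using hab.2
    nlinarith) Finset.univ ⟨⟨0, hn⟩, Finset.mem_univ _⟩
  have h2 := two_mul_edgeCount G
  simp only [Finset.card_univ, Fintype.card_fin] at h1
  nlinarith

end DiracAux

/-- For even `k ≥ 6`, `t = (k-2)/2` and `F` with `p(F) ≥ t+1` satisfying
`ex(k-1,F)/(k-2) ≤ (k-2)/2`, one has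
`ex(n, {𝓒_{≥k}, F}) = ((k-2)/2)·n + O_k(1)`. -/
theorem stmt14 {α : Type*} [Fintype α] (k : ℕ) (hk : 6 ≤ k) (hkeven : Even k)
    (F : SimpleGraph α) (hpF : PGE F ((k - 2) / 2 + 1))
    (hsmall : (exMax (k - 1) (fun G => ¬ ContainsCopy F G) : ℝ) / ((k : ℝ) - 2)
      ≤ ((k : ℝ) - 2) / 2) :
    ∃ (C : ℝ) (N : ℕ), ∀ n : ℕ, N ≤ n →
      |(exMax n (fun G => ¬ HasCycleGE G k ∧ ¬ ContainsCopy F G) : ℝ)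
        - ((k : ℝ) - 2) / 2 * (n : ℝ)| ≤ C := by
  obtain ⟨t, rfl⟩ : ∃ t, k = 2 * t + 2 := by
    obtain ⟨r, hr⟩ := hkeven
    exact ⟨r - 1, by omega⟩
  have ht : 2 ≤ t := by omega
  have e1 : (2 * t + 2 - 2) / 2 + 1 = t + 1 := by omega
  have e2 : 2 * t + 2 - 1 = 2 * t + 1 := by omega
  rw [e1] at hpF
  rw [e2] at hsmall
  have e3 : (((2 * t + 2 : ℕ) : ℝ) - 2) = 2 * t := by push_cast; ring
  rw [e3] at hsmall ⊢
  have e4 : (2 * (t : ℝ)) / 2 = t := by ring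
  rw [e4] at hsmall ⊢
  have htpos : (0 : ℝ) < 2 * t := by
    have : (0 : ℝ) < t := by exact_mod_cast (by omega : 0 < t)
    linarith
  have hs : exMax (2 * t + 1) (fun G => ¬ ContainsCopy F G) ≤ 2 * t * t := by
    rw [div_le_iff₀ htpos] at hsmall
    have : (exMax (2 * t + 1) (fun G => ¬ ContainsCopy F G) : ℝ) ≤ ((2 * t * t : ℕ) : ℝ) := by
      push_cast
      linarith
    exact_mod_cast this
  refine ⟨(t : ℝ) * t, t, ?_⟩
  intro n hn
  have hmem : DiracAux.kb t n ∈ {G : SimpleGraph (Fin n) |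
      ¬ HasCycleGE G (2 * t + 2) ∧ ¬ ContainsCopy F G} :=
    ⟨DiracAux.kb_cycle t n, DiracAux.kb_free F t n hpF⟩
  have hlow : t * (n - t) ≤
      exMax n (fun G => ¬ HasCycleGE G (2 * t + 2) ∧ ¬ ContainsCopy F G) :=
    le_trans (DiracAux.kb_edges t n hn)
      (le_csSup (DiracAux.exMax_bdd _ _) ⟨DiracAux.kb t n, hmem, rfl⟩)
  have hup : exMax n (fun G => ¬ HasCycleGE G (2 * t + 2) ∧ ¬ ContainsCopy F G) ≤ t * n := by
    refine csSup_le ⟨_, DiracAux.kb t n, hmem, rfl⟩ ?_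
    rintro m ⟨G, ⟨h1, h2⟩, rfl⟩
    exact DiracAux.upper F t n ht hs G h1 h2
  have hlow' : (t : ℝ) * (n - t) ≤
      (exMax n (fun G => ¬ HasCycleGE G (2 * t + 2) ∧ ¬ ContainsCopy F G) : ℝ) := by
    have := (Nat.cast_le (α := ℝ)).2 hlow
    rwa [Nat.cast_mul, Nat.cast_sub hn] at this
  have hup' : (exMax n (fun G => ¬ HasCycleGE G (2 * t + 2) ∧ ¬ ContainsCopy F G) : ℝ) ≤
      (t : ℝ) * n := by exact_mod_cast hup
  rw [abs_le]
  constructor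
  · nlinarith
  · nlinarith [mul_self_nonneg (t : ℝ)]
end

section
/- Let k ≥ 6 be even and let F be a graph. Let B be a 2-connected graph on b ≥ k vertices that contains no cycle of length ≥ k and no copy of F, and suppose the longest cycle of B has length exactly k−1. Then e(B) ≤ ex(k-1,F) + ((k-2)/2)·(b − 1) − (k-2)²/2. -/
open SimpleGraph

namespace BlockBound

open Finset

variable {V : Type*}

/-- `p` is the vertex list of a path from `x` to `y`. -/
structure IsP (G : SimpleGraph V) (x : V) (p : List V) (y : V) : Prop where
  chain : p.IsChain G.Adj
  nodup : p.Nodup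
  head : p.head? = some x
  last : p.getLast? = some y

/-- `p` is the vertex list of a cycle. -/
def IsCyc (G : SimpleGraph V) (p : List V) : Prop :=
  ∃ x y, IsP G x p y ∧ G.Adj y x ∧ 3 ≤ p.length

theorem IsP.single (G : SimpleGraph V) (x : V) : IsP G x [x] x :=
  ⟨by simp, by simp, by simp, by simp⟩

theorem IsP.append {G : SimpleGraph V} {x y y' z : V} {p q : List V} (hp : IsP G x p y)
    (hq : IsP G y' q z) (h : G.Adj y y') (hd : ∀ a ∈ p, a ∉ q) : IsP G x (p ++ q) z := by
  refine ⟨?_, ?_, ?_, ?_⟩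
  · rw [List.isChain_append]
    refine ⟨hp.chain, hq.chain, ?_⟩
    intro a ha b hb
    rw [hp.last] at ha
    rw [hq.head] at hb
    simp at ha hb
    subst ha hb
    exact h
  · rw [List.nodup_append]
    refine ⟨hp.nodup, hq.nodup, ?_⟩
    intro a ha b hb hab
    subst hab
    exact hd _ ha hb
  · rw [List.head?_append, hp.head]; rfl
  · rw [List.getLast?_append, hq.last]; rfl

theorem IsP.cons {G : SimpleGraph V} {x y z : V} {q : List V} 
    (hq : IsP G y q z) (h : G.Adj x y) (hd : x ∉ q) : IsP G x (x :: q) z := by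
  have := (IsP.single G x).append hq h (by simpa using hd)
  simpa using this

theorem IsP.split_left {G : SimpleGraph V} {x y b : V} {l₁ l₂ : List V}
    (h : IsP G x (l₁ ++ b :: l₂) y) : IsP G x (l₁ ++ [b]) b := by
  have e : l₁ ++ b :: l₂ = (l₁ ++ [b]) ++ l₂ := by simp
  have hc := h.chain
  have hn := h.nodup
  have hh := h.head
  rw [e] at hc hn hh
  refine ⟨(List.isChain_append.1 hc).1, (List.nodup_append.1 hn).1, ?_, by simp⟩
  cases l₁ <;> simpa using hh

theorem IsP.split_right {G : SimpleGraph V} {x y b : V} {l₁ l₂ : List V}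
    (h : IsP G x (l₁ ++ b :: l₂) y) : IsP G b (b :: l₂) y := by
  have hc := h.chain
  have hn := h.nodup
  have hh := h.last
  refine ⟨(List.isChain_append.1 hc).2.1, (List.nodup_append.1 hn).2.1, by simp, ?_⟩
  rw [List.getLast?_append] at hh
  rw [← hh]
  simp [List.getLast?_cons]

theorem IsP.reverse {G : SimpleGraph V} {x y : V} {p : List V} (h : IsP G x p y) :
    IsP G y p.reverse x := by
  refine ⟨?_, by simpa using h.nodup, by simpa using h.last, by simpa using h.head⟩
  rw [List.isChain_reverse]
  exact h.chain.imp fun a b hab => hab.symm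

theorem IsP.mem_head {G : SimpleGraph V} {x y : V} {p : List V} (h : IsP G x p y) : x ∈ p :=
  List.mem_of_mem_head? (by rw [h.head]; rfl)

theorem IsP.mem_last {G : SimpleGraph V} {x y : V} {p : List V} (h : IsP G x p y) : y ∈ p := 
  List.mem_of_mem_getLast? (by rw [h.last]; rfl)

theorem IsP.cons_eq {G : SimpleGraph V} {x y : V} {p : List V} (h : IsP G x p y) :
    ∃ l, p = x :: l := by
  have := h.head
  cases p with
  | nil => simp at this
  | cons a l => simp at this; exact ⟨l, by rw [this]⟩

/-- Joining two paths at a common vertex. -/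
theorem IsP.trans {G : SimpleGraph V} {x y z : V} {p q : List V} (hp : IsP G x p y)
    (hq : IsP G y q z) (hd : ∀ a ∈ p, a ∈ q → a = y) :
    ∃ r, IsP G x r z ∧ p.length ≤ r.length ∧ ∀ a ∈ r, a ∈ p ∨ a ∈ q := by
  obtain ⟨l, rfl⟩ := hq.cons_eq
  cases l with
  | nil =>
    have := hq.last
    simp at this
    subst this
    exact ⟨p, hp, le_rfl, fun a ha => Or.inl ha⟩
  | cons b l =>
    have hc := hq.chain
    have hn := hq.nodup
    rw [List.isChain_cons_cons] at hc
    have hq' : IsP G b (b :: l) z :=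
      ⟨hc.2, (List.nodup_cons.1 hn).2, by simp, by simpa using hq.last⟩
    refine ⟨p ++ b :: l, hp.append hq' hc.1 ?_, by simp, ?_⟩
    · intro a ha hb
      have := hd a ha (List.mem_cons_of_mem _ hb)
      subst this
      exact (List.nodup_cons.1 hn).1 hb
    · intro a ha
      rw [List.mem_append] at ha
      exact ha.imp id (List.mem_cons_of_mem _)

theorem IsCyc.rotate {G : SimpleGraph V} {p : List V} (h : IsCyc G p) {w : V} (hw : w ∈ p) :
    ∃ l, IsCyc G (w :: l) ∧ (∀ a, a ∈ w :: l ↔ a ∈ p) ∧ (w :: l).length = p.length := by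
  obtain ⟨x, y, hp, hyx, h3⟩ := h
  obtain ⟨l₁, l₂, rfl⟩ := List.append_of_mem hw
  cases l₁ with
  | nil => exact ⟨l₂, ⟨x, y, hp, hyx, h3⟩, by simp, by simp⟩
  | cons b l₁ =>
    have h1 := hp.split_right
    have hx : b = x := by simpa using hp.head
    subst hx
    have hc := hp.chain
    have hn := hp.nodup
    rw [List.isChain_append] at hc
    rw [List.nodup_append] at hn
    obtain ⟨u, hu⟩ : ∃ u, (b :: l₁).getLast? = some u := by
      simp [List.getLast?_cons]
    have h2 : IsP G b (b :: l₁) u := ⟨hc.1, hn.1, by simp, hu⟩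
    have h3' := h1.append h2 hyx (fun a ha hb => hn.2.2 a hb a ha rfl)
    refine ⟨l₂ ++ b :: l₁, ⟨w, u, by simpa using h3', hc.2.2 u hu w (by simp), ?_⟩, ?_, ?_⟩
    · simp at h3 ⊢; omega
    · intro a; simp; tauto
    · simp; omega

/-- Connectivity of a vertex set, in cut form. -/
def Conn (G : SimpleGraph V) (W : Finset V) : Prop :=
  ∀ S : Finset V, S ⊆ W → S.Nonempty → (∀ a ∈ S, ∀ b ∈ W, G.Adj a b → b ∈ S) → W ⊆ S

/-- The vertices reachable from `x` by a path inside `D`. -/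
noncomputable def Reach (G : SimpleGraph V) (D : Finset V) (x : V) : Finset V := by
  classical
  exact D.filter fun y => ∃ p, IsP G x p y ∧ ∀ a ∈ p, a ∈ D

theorem mem_Reach {G : SimpleGraph V} {D : Finset V} {x y : V} :
    y ∈ Reach G D x ↔ ∃ p, IsP G x p y ∧ ∀ a ∈ p, a ∈ D := by
  classical
  unfold Reach
  rw [Finset.mem_filter]
  constructor
  · exact fun h => h.2
  · rintro ⟨p, hp, hD⟩
    exact ⟨hD _ hp.mem_last, p, hp, hD⟩

theorem Reach_subset {G : SimpleGraph V} {D : Finset V} {x : V} : Reach G D x ⊆ D := by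
  intro y hy
  obtain ⟨p, hp, h⟩ := mem_Reach.1 hy
  exact h _ hp.mem_last

theorem self_mem_Reach {G : SimpleGraph V} {D : Finset V} {x : V} (h : x ∈ D) :
    x ∈ Reach G D x := mem_Reach.2 ⟨[x], IsP.single G x, by simpa using h⟩

theorem Reach_closed {G : SimpleGraph V} {D : Finset V} {x a b : V} (ha : a ∈ Reach G D x)
    (hb : b ∈ D) (hab : G.Adj a b) : b ∈ Reach G D x := by
  classical
  obtain ⟨p, hp, h⟩ := mem_Reach.1 ha
  rw [mem_Reach]
  by_cases hbp : b ∈ p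
  · obtain ⟨l₁, l₂, rfl⟩ := List.append_of_mem hbp
    refine ⟨l₁ ++ [b], hp.split_left, ?_⟩
    intro c hc
    apply h
    simp at hc ⊢
    tauto
  · refine ⟨p ++ [b], hp.append (IsP.single G b) hab ?_, ?_⟩
    · intro c hc hc'
      simp at hc'
      subst hc'
      exact hbp hc
    · intro c hc
      simp at hc
      rcases hc with hc | rfl
      · exact h _ hc
      · exact hb

theorem Conn.exists_path {G : SimpleGraph V} {W : Finset V} (h : Conn G W) {x y : V} (hx : x ∈ W)
    (hy : y ∈ W) : ∃ p, IsP G x p y ∧ ∀ a ∈ p, a ∈ W :=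
  mem_Reach.1 (h _ Reach_subset ⟨x, self_mem_Reach hx⟩
    (fun _ ha _ hb hab => Reach_closed ha hb hab) hy)

theorem conn_of_base {G : SimpleGraph V} {W : Finset V} {r : V} (hr : r ∈ W)
    (h : ∀ S : Finset V, S ⊆ W → S.Nonempty → r ∉ S →
      (∀ a ∈ S, ∀ b ∈ W, G.Adj a b → b ∈ S) → False) : Conn G W := by
  classical
  intro S hSW hS hcl
  by_cases hrS : r ∈ S
  · intro c hc
    by_contra hcS
    refine h (W \ S) Finset.sdiff_subset ⟨c, by simp [hc, hcS]⟩ (by simp [hrS]) ?_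
    intro a ha b hb hab
    rw [Finset.mem_sdiff] at ha ⊢
    exact ⟨hb, fun hbS => ha.2 (hcl b hbS a ha.1 hab.symm)⟩
  · exact (h S hSW hS hrS hcl).elim

/-- An edge leaving a proper nonempty subset. -/
theorem Conn.exists_edge {G : SimpleGraph V} {W S : Finset V} (h : Conn G W) (hS : S ⊆ W)
    (hne : S.Nonempty) {c : V} (hc : c ∈ W) (hcS : c ∉ S) :
    ∃ a ∈ S, ∃ b ∈ W, b ∉ S ∧ G.Adj a b := by
  by_contra hcon
  push Not at hcon
  refine hcS (h S hS hne ?_ hc)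
  intro a ha b hb hab
  by_contra hbS
  exact hcon a ha b hb hbS hab

/-- Dirac-type lemma on long paths with given ends. -/
theorem long_path [DecidableEq V] (G : SimpleGraph V) [DecidableRel G.Adj] (n : ℕ) :
    ∀ (L : Finset V) (x y : V) (d : ℕ), L.card ≤ n → x ∈ L → y ∈ L → x ≠ y → Conn G L →
      (∀ z ∈ L, Conn G (L.erase z)) → (∀ u ∈ L, u ≠ y → d ≤ (L.filter (G.Adj u)).card) →
      ∃ p, IsP G x p y ∧ (∀ a ∈ p, a ∈ L) ∧ d + 1 ≤ p.length := by
  induction n with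
  | zero =>
    intro L x y d hL hx
    rw [Nat.le_zero, Finset.card_eq_zero] at hL
    subst hL
    simp at hx
  | succ n ih =>
    intro L x y d hL hx hy hxy hC hC2 hd
    rcases d with _ | d
    · obtain ⟨p, hp, hpL⟩ := hC.exists_path hx hy
      refine ⟨p, hp, hpL, ?_⟩
      have := List.length_pos_of_mem hp.mem_head
      omega
    -- the separating pairs
    by_cases hM : (L.erase x).erase y = ∅
    · have hL2 : ∀ a ∈ L, a = x ∨ a = y := by
        intro a ha
        by_contra hcon
        push Not at hcon
        have : a ∈ (L.erase x).erase y := by simp [ha, hcon.1, hcon.2]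
        rw [hM] at this
        simp at this
      have hsub : L.filter (G.Adj x) ⊆ {y} := by
        intro a ha
        rw [Finset.mem_filter] at ha
        rcases hL2 a ha.1 with rfl | rfl
        · exact (G.loopless.irrefl _ ha.2).elim
        · simp
      have h1 := hd x hx hxy
      have h2 := Finset.card_le_card hsub
      simp at h2
      have hpos : 0 < (L.filter (G.Adj x)).card := by omega
      obtain ⟨a, ha⟩ := Finset.card_pos.1 hpos
      have hay := hsub ha
      simp at hay
      subst hay
      have hadj := (Finset.mem_filter.1 ha).2
      refine ⟨[x, a], (IsP.single G a).cons hadj (by simpa using hxy), ?_, ?_⟩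
      · simp [hx, hy]
      · simp; omega
    · let Q : Finset V × V → Prop := fun q => q.2 ∈ L.erase x ∧ q.1 ⊆ (L.erase x).erase q.2 ∧
        q.1.Nonempty ∧ y ∉ q.1 ∧ ∀ a ∈ q.1, ∀ b ∈ L.erase x, G.Adj a b → b ∈ q.1 ∨ b = q.2
      have hex : ∃ m, ∃ q, Q q ∧ q.1.card = m := by
        refine ⟨_, ((L.erase x).erase y, y), ⟨?_, subset_rfl, ?_, by simp, ?_⟩, rfl⟩
        · simp [hy, hxy.symm]
        · exact Finset.nonempty_iff_ne_empty.2 hM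
        · intro a _ b hb _
          by_cases hby : b = y
          · exact Or.inr hby
          · left
            exact Finset.mem_erase.2 ⟨hby, hb⟩
      classical
      obtain ⟨⟨A, z⟩, hQ, hcard⟩ := Nat.find_spec hex
      have hmin : ∀ q, Q q → A.card ≤ q.1.card := by
        intro q hq
        rw [hcard]
        exact Nat.find_min' hex ⟨q, hq, rfl⟩
      obtain ⟨hz, hA, hAne, hyA, hcl⟩ := hQ
      simp only at hz hA hAne hyA hcl hcard
      have hzx : z ≠ x := (Finset.mem_erase.1 hz).1
      have hzL : z ∈ L := (Finset.mem_erase.1 hz).2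
      have hAM : ∀ a ∈ A, a ∈ L.erase x := fun a ha => Finset.mem_of_mem_erase (hA ha)
      have hAL : ∀ a ∈ A, a ∈ L := fun a ha => Finset.mem_of_mem_erase (hAM a ha)
      have hxA : x ∉ A := fun h => by simpa using hAM x h
      have hzA : z ∉ A := fun h => by simpa using hA h
      have hL'M : ∀ a ∈ insert z A, a ∈ L.erase x := by
        intro a ha
        rcases Finset.mem_insert.1 ha with rfl | ha
        · exact hz
        · exact hAM a ha
      obtain ⟨x', hx'A, b, hb, hbA, hadj⟩ := (hC2 z hzL).exists_edge (S := A) (c := x)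
        (fun a ha => Finset.mem_erase.2 ⟨fun h => hzA (h ▸ ha), hAL a ha⟩) hAne
        (Finset.mem_erase.2 ⟨hzx.symm, hx⟩) hxA
      have hbx : b = x := by
        by_contra hbx
        rw [Finset.mem_erase] at hb
        rcases hcl x' hx'A b (Finset.mem_erase.2 ⟨hbx, hb.2⟩) hadj with h | h
        · exact hbA h
        · exact hb.1 h
      subst hbx
      -- connectivity of the new set
      have key : ∀ S, S ⊆ A → S.Nonempty → (∀ a ∈ S, ∀ c ∈ insert z A, G.Adj a c → c ∈ S) →
          False := by
        intro S hSA hSne hScl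
        have hzS : z ∉ S := fun h => hzA (hSA h)
        refine hzS (hC2 b hx S (fun a ha => hAM a (hSA ha)) hSne ?_ hz)
        intro a ha c hc hac
        refine hScl a ha c ?_ hac
        rw [Finset.mem_insert]
        exact (hcl a (hSA ha) c hc hac).symm
      have hC' : Conn G (insert z A) := by
        refine conn_of_base (r := z) (by simp) ?_
        intro S hS hSne hzS hScl
        refine key S ?_ hSne hScl
        intro a ha
        rcases Finset.mem_insert.1 (hS ha) with rfl | h
        · exact (hzS ha).elim
        · exact h
      have hC2' : ∀ z' ∈ insert z A, Conn G ((insert z A).erase z') := by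
        intro z' hz'
        rcases Finset.mem_insert.1 hz' with rfl | hz'A
        · rw [Finset.erase_insert hzA]
          intro S hS hSne hScl
          have := hmin (S, z') ⟨hz, fun a ha => hA (hS ha), hSne, fun h => hyA (hS h), ?_⟩
          · exact (Finset.eq_of_subset_of_card_le hS this).ge
          · intro a ha c hc hac
            rcases hcl a (hS ha) c hc hac with h | h
            · exact Or.inl (hScl a ha c h hac)
            · exact Or.inr h
        · have hz'z : z ≠ z' := fun h => hzA (h ▸ hz'A)
          refine conn_of_base (r := z) (by simp [hz'z]) ?_
          intro S hS hSne hzS hScl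
          have hSA : S ⊆ A.erase z' := by
            intro a ha
            have := hS ha
            rw [Finset.mem_erase, Finset.mem_insert] at this
            rw [Finset.mem_erase]
            refine ⟨this.1, this.2.resolve_left ?_⟩
            rintro rfl
            exact hzS ha
          have h1 := hmin (S, z') ⟨hAM _ hz'A, ?_, hSne, ?_, ?_⟩
          · have h2 := Finset.card_le_card hSA
            have h3 := Finset.card_erase_lt_of_mem hz'A
            simp only at h1
            omega
          · exact hSA.trans (Finset.erase_subset_erase _ hAM)
          · exact fun h => hyA (Finset.mem_of_mem_erase (hSA h))
          · intro a ha c hc hac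
            by_cases hcz : c = z'
            · exact Or.inr hcz
            · left
              refine hScl a ha c ?_ hac
              rw [Finset.mem_erase, Finset.mem_insert]
              exact ⟨hcz, (hcl a (Finset.mem_of_mem_erase (hSA ha)) c hc hac).symm⟩
      have hcard' : (insert z A).card ≤ n := by
        have h1 := Finset.card_le_card (show insert z A ⊆ L.erase b from hL'M)
        have h2 := Finset.card_erase_lt_of_mem hx
        omega
      obtain ⟨p, hp, hpA, hplen⟩ := ih (insert z A) x' z d hcard' (by simp [hx'A]) (by simp)
        (fun h => hzA (h ▸ hx'A)) hC' hC2' (by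
          intro u hu huz
          have huA : u ∈ A := (Finset.mem_insert.1 hu).resolve_left huz
          have h1 := hd u (hAL u huA) (fun h => hyA (h ▸ huA))
          have h2 : L.filter (G.Adj u) ⊆ insert b ((insert z A).filter (G.Adj u)) := by
            intro c hc
            rw [Finset.mem_filter] at hc
            by_cases hcb : c = b
            · simp [hcb]
            · refine Finset.mem_insert_of_mem (Finset.mem_filter.2 ⟨?_, hc.2⟩)
              rw [Finset.mem_insert]
              exact (hcl u huA c (Finset.mem_erase.2 ⟨hcb, hc.1⟩) hc.2).symm
          have h3 := Finset.card_le_card h2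
          have h4 := Finset.card_insert_le b ((insert z A).filter (G.Adj u))
          omega)
      -- the continuation to `y`
      have hzD : z ∈ L.erase b \ A := Finset.mem_sdiff.2 ⟨hz, hzA⟩
      have hyR : y ∈ Reach G (L.erase b \ A) z := by
        have hcov := hC2 b hx (A ∪ Reach G (L.erase b \ A) z) ?_ ?_ ?_
          (Finset.mem_erase.2 ⟨hxy.symm, hy⟩)
        · exact (Finset.mem_union.1 hcov).resolve_left hyA
        · exact Finset.union_subset hAM (Reach_subset.trans Finset.sdiff_subset)
        · exact hAne.mono Finset.subset_union_left
        · intro a ha c hc hac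
          rw [Finset.mem_union] at ha ⊢
          rcases ha with ha | ha
          · rcases hcl a ha c hc hac with h | h
            · exact Or.inl h
            · subst h
              exact Or.inr (self_mem_Reach hzD)
          · by_cases hcA : c ∈ A
            · exact Or.inl hcA
            · exact Or.inr (Reach_closed ha (Finset.mem_sdiff.2 ⟨hc, hcA⟩) hac)
      obtain ⟨q, hq, hqD⟩ := mem_Reach.1 hyR
      have hbp : b ∉ p := fun h => by simpa using hL'M _ (hpA _ h)
      have hbp' := hp.cons hadj.symm hbp
      obtain ⟨r, hr, hrlen, hrmem⟩ := hbp'.trans hq (by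
        intro a ha haq
        have haD := hqD a haq
        rw [Finset.mem_sdiff] at haD
        rcases List.mem_cons.1 ha with rfl | ha
        · simp at haD
        · exact (Finset.mem_insert.1 (hpA a ha)).resolve_right haD.2)
      refine ⟨r, hr, ?_, ?_⟩
      · intro a ha
        rcases hrmem a ha with h | h
        · rcases List.mem_cons.1 h with rfl | h
          · exact hx
          · exact Finset.mem_of_mem_erase (hL'M _ (hpA a h))
        · exact Finset.mem_of_mem_erase (Finset.mem_sdiff.1 (hqD a h)).1
      · simp at hrlen
        omega

theorem sparse_card (P : Finset ℕ) (m N : ℕ) (hlo : ∀ i ∈ P, m ≤ i) (hhi : ∀ i ∈ P, i + m < N)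
    (hs : ∀ i ∈ P, i + 1 ∉ P) (hne : P.Nonempty) : 2 * P.card + 2 * m ≤ N + 1 := by
  classical
  have hd : Disjoint P (P.image (· + 1)) := by
    rw [Finset.disjoint_left]
    intro i hi hi'
    obtain ⟨j, hj, rfl⟩ := Finset.mem_image.1 hi'
    exact hs j hj hi
  have hsub : P ∪ P.image (· + 1) ⊆ Finset.Ico m (N + 1 - m) := by
    intro i hi
    rw [Finset.mem_Ico]
    rcases Finset.mem_union.1 hi with h | h
    · have := hlo i h
      have := hhi i h
      omega
    · obtain ⟨j, hj, rfl⟩ := Finset.mem_image.1 h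
      have := hlo j hj
      have := hhi j hj
      omega
  have h1 := Finset.card_le_card hsub
  rw [Finset.card_union_of_disjoint hd,
    Finset.card_image_of_injective _ (fun a b h => by simpa using h), Nat.card_Ico] at h1
  obtain ⟨i, hi⟩ := hne
  have := hlo i hi
  have := hhi i hi
  omega

theorem gap [DecidableEq V] {G : SimpleGraph V} [DecidableRel G.Adj] {t : ℕ} {C : List V}
    (hC : IsCyc G C) (hlen : C.length = 2 * t + 1)
    (hno : ∀ p, IsCyc G p → p.length ≤ 2 * t + 1) {u v w : V} {Q : List V} (hQ : IsP G v Q u)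
    (hQC : ∀ a ∈ Q, a ∉ C) (hw : w ∈ C) (huw : G.Adj u w)
    (h2 : 2 ≤ (insert w (C.toFinset.filter (G.Adj v))).card) :
    (insert w (C.toFinset.filter (G.Adj v))).card + Q.length ≤ t + 1 := by
  obtain ⟨l, hl, hmem, hll⟩ := hC.rotate hw
  obtain ⟨x, y, hP, hyx, h3⟩ := hl
  have hxw : w = x := by simpa using hP.head
  subst hxw
  have hQl : ∀ a ∈ Q, a ∉ w :: l := fun a ha h => hQC a ha ((hmem a).1 h)
  have hvl : v ∉ w :: l := hQl v hQ.mem_head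
  have hQpos := List.length_pos_of_mem hQ.mem_head
  have hl2 : l.length = 2 * t := by simp at hll; omega
  have hnod := hP.nodup
  let P : Finset ℕ := (Finset.range l.length).filter fun i => ∃ h : i < l.length, G.Adj v l[i]
  have hspl : ∀ i (h : i < l.length), l = l.take i ++ l[i] :: l.drop (i + 1) := by
    intro i h
    simp
  have hsub : insert w (C.toFinset.filter (G.Adj v)) ⊆
      insert w (P.image fun i => l.getD i w) := by
    intro a ha
    rcases Finset.mem_insert.1 ha with rfl | ha
    · simp
    · rw [Finset.mem_filter, List.mem_toFinset, ← hmem] at ha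
      rcases List.mem_cons.1 ha.1 with rfl | hal
      · simp
      · refine Finset.mem_insert_of_mem (Finset.mem_image.2 ?_)
        obtain ⟨i, hi, rfl⟩ := List.getElem_of_mem hal
        refine ⟨i, Finset.mem_filter.2 ⟨by simpa using hi, hi, ha.2⟩, ?_⟩
        exact List.getD_eq_getElem _ _ hi
  have hcard : (insert w (C.toFinset.filter (G.Adj v))).card ≤ P.card + 1 :=
    (Finset.card_le_card hsub).trans
      ((Finset.card_insert_le _ _).trans (Nat.succ_le_succ Finset.card_image_le))
  have hPne : P.Nonempty := by
    rw [← Finset.card_pos]; omega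
  have hlo : ∀ i ∈ P, Q.length ≤ i := by
    intro i hi
    obtain ⟨-, hil, hadj⟩ := Finset.mem_filter.1 hi
    have e := hspl i hil
    set l₁ := l.take i with hl₁
    set l₂ := l.drop (i + 1) with hl₂
    have hP' : IsP G w ((w :: l₁) ++ l[i] :: l₂) y := by
      rw [List.cons_append, ← e]; exact hP
    have hR := hP'.split_right
    have hcyc : IsCyc G (w :: (Q.reverse ++ l[i] :: l₂)) := by
      have hsubl : ∀ a ∈ l[i] :: l₂, a ∈ l := by
        intro a ha
        rw [e]
        exact List.mem_append_right _ ha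
      refine ⟨w, y, (hQ.reverse.append hR hadj ?_).cons huw.symm ?_, hyx, ?_⟩
      · intro a ha ha'
        exact hQl a (by simpa using ha) (List.mem_cons_of_mem _ (hsubl a ha'))
      · intro h
        rcases List.mem_append.1 h with h | h
        · exact hQl w (by simpa using h) (by simp)
        · exact (List.nodup_cons.1 hnod).1 (hsubl w h)
      · simp; omega
    have := hno _ hcyc
    have h5 : l₂.length = l.length - (i + 1) := by simp [hl₂]
    simp only [List.length_cons, List.length_append, List.length_reverse] at this
    omega
  have hhi : ∀ i ∈ P, i + Q.length < 2 * t := by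
    intro i hi
    obtain ⟨-, hil, hadj⟩ := Finset.mem_filter.1 hi
    have e := hspl i hil
    set l₁ := l.take i with hl₁
    set l₂ := l.drop (i + 1) with hl₂
    have hP' : IsP G w ((w :: l₁) ++ l[i] :: l₂) y := by
      rw [List.cons_append, ← e]; exact hP
    have hR := hP'.split_left
    have hsubl : ∀ a ∈ w :: l₁ ++ [l[i]], a ∈ w :: l := by
      intro a ha
      rw [e]
      simp at ha ⊢
      tauto
    have hcyc : IsCyc G ((w :: l₁ ++ [l[i]]) ++ Q) := by
      refine ⟨w, u, hR.append hQ hadj.symm ?_, huw, ?_⟩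
      · intro a ha ha'
        exact hQl a ha' (hsubl a ha)
      · simp; omega
    have := hno _ hcyc
    have h5 : l₁.length = i := by simp [hl₁]; omega
    simp only [List.length_cons, List.length_append, List.length_nil] at this
    omega
  have hs : ∀ i ∈ P, i + 1 ∉ P := by
    intro i hi hi'
    obtain ⟨-, hil, hadj⟩ := Finset.mem_filter.1 hi
    obtain ⟨-, hil', hadj'⟩ := Finset.mem_filter.1 hi'
    have e := hspl i hil
    have e2 : l.drop (i + 1) = l[i + 1] :: l.drop (i + 2) := by
      simp
    rw [e2] at e
    set l₁ := l.take i with hl₁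
    set l₂ := l.drop (i + 2) with hl₂
    have hP' : IsP G w ((w :: l₁) ++ l[i] :: (l[i + 1] :: l₂)) y := by
      rw [List.cons_append, ← e]; exact hP
    have hL := hP'.split_left
    have hP'' : IsP G w ((w :: l₁ ++ [l[i]]) ++ l[i + 1] :: l₂) y := by
      simpa using hP'
    have hR := hP''.split_right
    have hall : ∀ a, a ∈ (w :: l₁ ++ [l[i]]) ++ l[i + 1] :: l₂ ↔ a ∈ w :: l := by
      intro a
      conv_rhs => rw [e]
      simp
    have hcyc : IsCyc G ((w :: l₁ ++ [l[i]]) ++ v :: (l[i + 1] :: l₂)) := by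
      refine ⟨w, y, hL.append (hR.cons hadj' ?_) hadj.symm ?_, hyx, ?_⟩
      · intro h
        exact hvl ((hall v).1 (List.mem_append_right _ h))
      · intro a ha ha'
        rcases List.mem_cons.1 ha' with rfl | ha'
        · exact hvl ((hall a).1 (List.mem_append_left _ ha))
        · exact (List.nodup_append.1 hP''.nodup).2.2 a ha a ha' rfl
      · simp; omega
    have := hno _ hcyc
    have h5 : l₁.length = i := by simp [hl₁]; omega
    have h6 : l₂.length = l.length - (i + 2) := by simp [hl₂]
    simp only [List.length_cons, List.length_append, List.length_nil] at this
    omega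
  have := sparse_card P Q.length (2 * t) hlo hhi hs hPne
  omega

/-- In a 2-connected set every vertex has a neighbour that can be contracted into it. -/
theorem exists_contractible_aux [DecidableEq V] {G : SimpleGraph V} {W : Finset V}
    (h2 : ∀ z ∈ W, Conn G (W.erase z)) {v r : V} (hv : v ∈ W) (hr : r ∈ W) (hrv : r ≠ v) (n : ℕ) :
    ∀ (u : V) (S : Finset V), S.card ≤ n → u ∈ W → G.Adj v u → u ≠ r →
      S ⊆ (W.erase v).erase u → S.Nonempty → r ∉ S →
      (∀ a ∈ S, ∀ b ∈ (W.erase v).erase u, G.Adj a b → b ∈ S) →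
      ∃ u ∈ W, G.Adj v u ∧ Conn G ((W.erase v).erase u) := by
  induction n with
  | zero =>
    intro u S hS _ _ _ _ hne
    rw [Nat.le_zero, Finset.card_eq_zero] at hS
    subst hS
    simp at hne
  | succ n ih =>
    intro u S hcard hu hvu hur hSW hSne hrS hScl
    have huv : u ≠ v := hvu.ne'
    have hvS : v ∉ S := fun h => by simpa using hSW h
    have huS : u ∉ S := fun h => by simpa using hSW h
    have hSW' : ∀ a ∈ S, a ∈ W := fun a ha => Finset.mem_of_mem_erase (Finset.mem_of_mem_erase (hSW ha))
    obtain ⟨a, haS, b, hb, hbS, hab⟩ := (h2 u hu).exists_edge (S := S) (c := v)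
      (fun a ha => Finset.mem_erase.2 ⟨fun h => huS (h ▸ ha), hSW' a ha⟩) hSne
      (Finset.mem_erase.2 ⟨huv.symm, hv⟩) hvS
    have hbv : b = v := by
      by_contra hbv
      rw [Finset.mem_erase] at hb
      exact hbS (hScl a haS b (by simp [hbv, hb.1, hb.2]) hab)
    subst hbv
    have har : a ≠ r := fun h => hrS (h ▸ haS)
    have hab' : a ≠ b := hab.ne
    by_cases hcon : Conn G ((W.erase b).erase a)
    · exact ⟨a, hSW' a haS, hab.symm, hcon⟩
    · have : ∃ S' : Finset V, S' ⊆ (W.erase b).erase a ∧ S'.Nonempty ∧ r ∉ S' ∧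
          ∀ c ∈ S', ∀ d ∈ (W.erase b).erase a, G.Adj c d → d ∈ S' := by
        by_contra hno
        push Not at hno
        refine hcon (conn_of_base (r := r) (by simp [har.symm, hrv, hr]) ?_)
        intro S' h1 h2 h3 h4
        obtain ⟨c, hc, d, hd, hcd, hd'⟩ := hno S' h1 h2 h3
        exact hd' (h4 c hc d hd hcd)
      obtain ⟨S', hS'W, hS'ne, hrS', hS'cl⟩ := this
      have haS' : a ∉ S' := fun h => by simpa using hS'W h
      -- `S` only meets the rest through `u`
      have hsep : ∀ c ∈ S, ∀ d ∈ W.erase b, d ∉ S → G.Adj c d → d = u := by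
        intro c hc d hd hdS hcd
        by_contra hdu
        exact hdS (hScl c hc d (Finset.mem_erase.2 ⟨hdu, hd⟩) hcd)
      have huM : u ∈ W.erase b := Finset.mem_erase.2 ⟨huv, hu⟩
      have huS' : u ∉ S' := by
        intro huS'
        have hT := h2 b hv (((W.erase b) \ S') \ S) (Finset.sdiff_subset.trans Finset.sdiff_subset)
          ⟨r, by simp [hr, hrv, hrS, hrS']⟩ ?_ huM
        · simp [huS'] at hT
        · intro c hc d hd hcd
          rw [Finset.mem_sdiff, Finset.mem_sdiff] at hc ⊢
          have hdS : d ∉ S := by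
            intro hdS
            have := hsep d hdS c hc.1.1 hc.2 hcd.symm
            subst this
            exact hc.1.2 huS'
          refine ⟨⟨hd, fun hdS' => hc.1.2 (hS'cl d hdS' c ?_ hcd.symm)⟩, hdS⟩
          exact Finset.mem_erase.2 ⟨fun h => hc.2 (h ▸ haS), hc.1.1⟩
      have hsub : S' ⊆ S.erase a := by
        intro e he
        rw [Finset.mem_erase]
        refine ⟨fun h => haS' (h ▸ he), ?_⟩
        by_contra heS
        have hT := h2 b hv (S' \ S) ?_ ⟨e, by simp [he, heS]⟩ ?_ huM
        · simp [huS'] at hT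
        · intro c hc
          exact Finset.mem_of_mem_erase (hS'W (Finset.mem_sdiff.1 hc).1)
        · intro c hc d hd hcd
          rw [Finset.mem_sdiff] at hc ⊢
          have hcM := Finset.mem_of_mem_erase (hS'W hc.1)
          have hdS : d ∉ S := by
            intro hdS
            have := hsep d hdS c hcM hc.2 hcd.symm
            subst this
            exact huS' hc.1
          exact ⟨hS'cl c hc.1 d (Finset.mem_erase.2 ⟨fun h => hdS (h ▸ haS), hd⟩) hcd, hdS⟩
      have hc1 := Finset.card_le_card hsub
      have hc2 := Finset.card_erase_lt_of_mem haS
      exact ih a S' (by omega) (hSW' a haS) hab.symm har hS'W hS'ne hrS' hS'cl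

theorem exists_contractible [DecidableEq V] {G : SimpleGraph V} {W : Finset V}
    (h2 : ∀ z ∈ W, Conn G (W.erase z)) {v r s : V} (hv : v ∈ W) (hr : r ∈ W) (hrv : r ≠ v)
    (hs : s ∈ W) (hsv : s ≠ v) (hsr : s ≠ r) :
    ∃ u ∈ W, G.Adj v u ∧ Conn G ((W.erase v).erase u) := by
  obtain ⟨a, ha, u, hu, hua, hau⟩ := (h2 r hr).exists_edge (S := {v}) (c := s)
    (by simp [hv, hrv.symm]) (by simp) (by simp [hs, hsr]) (by simpa using hsv)
  simp at ha
  subst ha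
  rw [Finset.mem_erase] at hu
  by_cases hcon : Conn G ((W.erase a).erase u)
  · exact ⟨u, hu.2, hau, hcon⟩
  · by_contra hno
    refine hcon (conn_of_base (r := r) (by simp [hu.1.symm, hrv, hr]) ?_)
    intro S h3 h4 h5 h6
    exact hno (exists_contractible_aux h2 hv hr hrv S.card u S le_rfl hu.2 hau hu.1 h3 h4 h5 h6)

/-- Contract `v` into `u`; the vertex `v` becomes isolated. -/
def contract (G : SimpleGraph V) (v u : V) : SimpleGraph V where
  Adj a b := a ≠ b ∧ a ≠ v ∧ b ≠ v ∧ (G.Adj a b ∨ (a = u ∧ G.Adj v b) ∨ (b = u ∧ G.Adj v a))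
  symm := ⟨by
    rintro a b ⟨h1, h2, h3, h4⟩
    refine ⟨h1.symm, h3, h2, ?_⟩
    rcases h4 with h | h | h
    · exact Or.inl h.symm
    · exact Or.inr (Or.inr h)
    · exact Or.inr (Or.inl h)⟩
  loopless := ⟨fun a h => h.1 rfl⟩

theorem contract_adj_of {G : SimpleGraph V} {v u a b : V} (h : G.Adj a b) (ha : a ≠ v)
    (hb : b ≠ v) : (contract G v u).Adj a b := ⟨h.ne, ha, hb, Or.inl h⟩

theorem contract_conn [DecidableEq V] {G : SimpleGraph V} {W : Finset V}
    (h2 : ∀ z ∈ W, Conn G (W.erase z)) {v u : V} (hv : v ∈ W) (hu : u ∈ W) (hvu : G.Adj v u)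
    (hc : Conn G ((W.erase v).erase u)) :
    ∀ z ∈ W.erase v, Conn (contract G v u) ((W.erase v).erase z) := by
  intro z hz
  rw [Finset.mem_erase] at hz
  by_cases hzu : z = u
  · subst hzu
    intro S hS hSne hScl
    refine hc S hS hSne ?_
    intro a ha b hb hab
    have ha' := hS ha
    simp only [Finset.mem_erase] at ha' hb
    exact hScl a ha b (by simp [hb]) (contract_adj_of hab ha'.2.1 hb.2.1)
  · intro S hS hSne hScl
    have hSp : ∀ a ∈ S, a ≠ z ∧ a ≠ v ∧ a ∈ W := by
      intro a ha
      simpa using hS ha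
    by_cases huS : u ∈ S
    · have := h2 z hz.2 (insert v S) ?_ (by simp) ?_
      · intro a ha
        simp only [Finset.mem_erase] at ha
        have h := this (Finset.mem_erase.2 ⟨ha.1, ha.2.2⟩)
        exact (Finset.mem_insert.1 h).resolve_left ha.2.1
      · intro a ha
        rcases Finset.mem_insert.1 ha with rfl | ha
        · simp [hv, hz.1.symm]
        · simp [(hSp a ha).1, (hSp a ha).2.2]
      · intro a ha b hb hab
        rw [Finset.mem_erase] at hb
        by_cases hbv : b = v
        · simp [hbv]
        refine Finset.mem_insert_of_mem ?_
        rcases Finset.mem_insert.1 ha with rfl | ha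
        · by_cases hbu : b = u
          · rw [hbu]; exact huS
          · exact hScl u huS b (by simp [hb, hbv])
              ⟨fun h => hbu h.symm, hvu.ne', hbv, Or.inr (Or.inl ⟨rfl, hab⟩)⟩
        · exact hScl a ha b (by simp [hb, hbv]) (contract_adj_of hab (hSp a ha).2.1 hbv)
    · exfalso
      have hvS : v ∉ S := fun h => (hSp v h).2.1 rfl
      refine hvS (h2 z hz.2 S ?_ hSne ?_ (by simp [hv, hz.1.symm]))
      · intro a ha
        simp [(hSp a ha).1, (hSp a ha).2.2]
      · intro a ha b hb hab
        rw [Finset.mem_erase] at hb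
        by_cases hbv : b = v
        · subst hbv
          exfalso
          refine huS (hScl a ha u ?_ ⟨fun h => huS (h ▸ ha), (hSp a ha).2.1, hvu.ne',
            Or.inr (Or.inr ⟨rfl, hab.symm⟩)⟩)
          simp [hu, hvu.ne', Ne.symm hzu]
        · exact hScl a ha b (by simp [hb, hbv]) (contract_adj_of hab (hSp a ha).2.1 hbv)

theorem contract_cyc {G : SimpleGraph V} {v u : V} (hvu : G.Adj v u) {p : List V}
    (hp : IsCyc (contract G v u) p) : ∃ q, IsCyc G q ∧ p.length ≤ q.length := by
  classical
  have good : ∀ {a b : V}, (contract G v u).Adj a b → a ≠ u → b ≠ u → G.Adj a b := by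
    rintro a b ⟨h1, h2, h3, h4⟩ ha hb
    rcases h4 with h | h | h
    · exact h
    · exact (ha h.1).elim
    · exact (hb h.1).elim
  by_cases hup : u ∈ p
  · obtain ⟨l, hl, hmem, hlen⟩ := hp.rotate hup
    obtain ⟨x, b, hP, hbx, h3⟩ := hl
    have hx : u = x := by simpa using hP.head
    subst hx
    have hnod := List.nodup_cons.1 hP.nodup
    cases l with
    | nil => simp at h3
    | cons a l =>
      have hch := List.isChain_cons_cons.1 hP.chain
      have hne : ∀ c ∈ a :: l, c ≠ u := fun c hc h => hnod.1 (h ▸ hc)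
      have hlast : (a :: l).getLast? = some b := by simpa using hP.last
      have hbmem : b ∈ a :: l := List.mem_of_mem_getLast? (by rw [hlast]; rfl)
      have hPl' : IsP (contract G v u) a (a :: l) b := ⟨hch.2, hnod.2, by simp, hlast⟩
      have hnv : ∀ c ∈ u :: a :: l, c ≠ v := by
        intro c hc hcv
        subst hcv
        -- every vertex of the list has a neighbour in the contracted graph
        obtain ⟨l₁, l₂, e⟩ := List.append_of_mem hc
        have hc' := hP.chain
        rw [e] at hc'
        cases l₂ with
        | nil =>
          have h := hP.last
          rw [e] at h
          simp at h
          subst h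
          exact hbx.2.1 rfl
        | cons d l₂ =>
          have := (List.isChain_append.1 hc').2.1
          exact (List.isChain_cons_cons.1 this).1.2.1 rfl
      have hPl : IsP G a (a :: l) b := by
        refine ⟨hPl'.chain.imp_of_mem_imp ?_, hnod.2, by simp, hlast⟩
        intro c d hc hd hcd
        exact good hcd (hne c hc) (hne d hd)
      have hvl : v ∉ a :: l := fun h => hnv v (List.mem_cons_of_mem _ h) rfl
      have hul : u ∉ a :: l := hnod.1
      have hua : G.Adj u a ∨ G.Adj v a := by
        rcases hch.1.2.2.2 with h | h | h
        · exact Or.inl h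
        · exact Or.inr h.2
        · exact (hne a (by simp) h.1).elim
      have hbu : G.Adj b u ∨ G.Adj b v := by
        rcases hbx.2.2.2 with h | h | h
        · exact Or.inl h
        · exact (hne b hbmem h.1).elim
        · exact Or.inr h.2.symm
      rw [← hlen]
      rcases hua with hua | hua <;> rcases hbu with hbu | hbu
      · exact ⟨u :: a :: l, ⟨u, b, hPl.cons hua hul, hbu, h3⟩, le_rfl⟩
      · refine ⟨v :: u :: a :: l, ⟨v, b, (hPl.cons hua hul).cons hvu ?_, hbu, ?_⟩, by simp⟩
        · simp only [List.mem_cons, not_or] at hvl ⊢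
          exact ⟨hvu.ne, hvl⟩
        · simp
      · refine ⟨u :: v :: a :: l, ⟨u, b, (hPl.cons hua hvl).cons hvu.symm ?_, hbu, ?_⟩, by simp⟩
        · simp only [List.mem_cons, not_or] at hul ⊢
          exact ⟨hvu.ne', hul⟩
        · simp
      · exact ⟨v :: a :: l, ⟨v, b, hPl.cons hua hvl, hbu, by simpa using h3⟩, by simp⟩
  · obtain ⟨x, y, hP, hyx, h3⟩ := hp
    have hne : ∀ c ∈ p, c ≠ u := fun c hc h => hup (h ▸ hc)
    refine ⟨p, ⟨x, y, ⟨hP.chain.imp_of_mem_imp ?_, hP.nodup, hP.head, hP.last⟩, ?_, h3⟩, le_rfl⟩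
    · intro c d hc hd hcd
      exact good hcd (hne c hc) (hne d hd)
    · exact good hyx (hne _ hP.mem_last) (hne _ hP.mem_head)

/-- If all vertices off a longest cycle have large degree, there is a contradiction. -/
theorem mindeg_contra [DecidableEq V] {G : SimpleGraph V} [DecidableRel G.Adj] {t : ℕ}
    (ht : 1 ≤ t) {C : List V}
    (hC : IsCyc G C) (hlen : C.length = 2 * t + 1)
    (hno : ∀ p, IsCyc G p → p.length ≤ 2 * t + 1) {W : Finset V} (hCW : ∀ a ∈ C, a ∈ W)
    (h2 : ∀ z ∈ W, Conn G (W.erase z)) {v₀ : V} (hv₀ : v₀ ∈ W) (hv₀C : v₀ ∉ C)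
    (hdeg : ∀ v ∈ W, v ∉ C → t + 1 ≤ (W.filter (G.Adj v)).card) : False := by
  -- another vertex on the cycle
  have hCnod : C.Nodup := by
    obtain ⟨x, y, hP, -⟩ := hC
    exact hP.nodup
  have hother : ∀ a, ∃ c ∈ C, c ≠ a := by
    intro a
    by_contra hcon
    push Not at hcon
    have hs : C.toFinset ⊆ {a} := by
      intro c hc
      simpa using hcon c (by simpa using hc)
    have := Finset.card_le_card hs
    rw [List.toFinset_card_of_nodup hCnod] at this
    simp at this
    omega
  let Q : Finset V × Finset V → Prop := fun q =>
    q.1.Nonempty ∧ (∀ a ∈ q.1, a ∈ W ∧ a ∉ C) ∧ (∀ a ∈ q.2, a ∈ W ∧ a ∉ C ∧ a ∉ q.1) ∧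
    q.2.card ≤ 1 ∧ ∀ a ∈ q.1, ∀ b ∈ W, G.Adj a b → b ∈ q.1 ∨ b ∈ q.2 ∨ b ∈ C
  have hex : ∃ m, ∃ q, Q q ∧ 2 * (q.1.card + q.2.card) + q.2.card = m := by
    refine ⟨_, (W.filter (· ∉ C), ∅), ⟨⟨v₀, by simp [hv₀, hv₀C]⟩, ?_, by simp, by simp, ?_⟩, rfl⟩
    · intro a ha
      simpa using ha
    · intro a _ b hb _
      by_cases hbC : b ∈ C
      · exact Or.inr (Or.inr hbC)
      · exact Or.inl (by simp [hb, hbC])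
  classical
  obtain ⟨⟨A, Z⟩, hQ, hcard⟩ := Nat.find_spec hex
  have hmin : ∀ q, Q q → 2 * (A.card + Z.card) + Z.card ≤ 2 * (q.1.card + q.2.card) + q.2.card := by
    intro q hq
    simp only at hcard
    rw [hcard]
    exact Nat.find_min' hex ⟨q, hq, rfl⟩
  obtain ⟨hAne, hA, hZ, hZ1, hcl⟩ := hQ
  simp only at hAne hA hZ hZ1 hcl
  clear hcard
  have hAC : ∀ a ∈ A, ∀ c ∈ C, c ≠ a := fun a ha c hc h => (hA a ha).2 (h ▸ hc)
  -- a vertex of `A` with the most neighbours on the cycle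
  obtain ⟨v, hvA, hvmax⟩ := Finset.exists_max_image A
    (fun a => (C.toFinset.filter (G.Adj a)).card) hAne
  set s := (C.toFinset.filter (G.Adj v)).card with hs
  have hdL : ∀ a ∈ A, t + 1 - s ≤ ((A ∪ Z).filter (G.Adj a)).card := by
    intro a ha
    have h1 := hdeg a (hA a ha).1 (hA a ha).2
    have h3 : W.filter (G.Adj a) ⊆ (A ∪ Z).filter (G.Adj a) ∪ C.toFinset.filter (G.Adj a) := by
      intro b hb
      rw [Finset.mem_filter] at hb
      simp only [Finset.mem_union, Finset.mem_filter, List.mem_toFinset]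
      have := hcl a ha b hb.1 hb.2
      tauto
    have h4 := (Finset.card_le_card h3).trans (Finset.card_union_le _ _)
    have h5 := hvmax a ha
    omega
  rcases Nat.eq_zero_or_pos Z.card with hZ0 | hZpos
  · -- no attachment vertex
    rw [Finset.card_eq_zero] at hZ0
    subst hZ0
    simp only [Finset.union_empty] at hdL
    simp only [Finset.notMem_empty, false_or, Finset.card_empty, Nat.add_zero] at hcl hmin
    have hCA : Conn G A := by
      intro S hS hSne hScl
      have := hmin (S, ∅) ⟨hSne, fun a ha => hA a (hS ha), by simp, by simp, ?_⟩
      · simp only [Finset.card_empty, Nat.add_zero] at this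
        exact (Finset.eq_of_subset_of_card_le hS (by omega)).ge
      · intro a ha b hb hab
        rcases hcl a (hS ha) b hb hab with h | h
        · exact Or.inl (hScl a ha b h hab)
        · exact Or.inr (Or.inr h)
    have hCA2 : ∀ z ∈ A, Conn G (A.erase z) := by
      intro z hz S hS hSne hScl
      have := hmin (S, {z}) ⟨hSne, fun a ha => hA a (Finset.mem_of_mem_erase (hS ha)), ?_,
        by simp, ?_⟩
      · simp only [Finset.card_singleton] at this
        have h3 := Finset.card_erase_of_mem hz
        exact (Finset.eq_of_subset_of_card_le hS (by omega)).ge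
      · intro a ha
        simp only [Finset.mem_singleton] at ha
        subst ha
        exact ⟨(hA a hz).1, (hA a hz).2, fun h => by simpa using hS h⟩
      · intro a ha b hb hab
        rcases hcl a (Finset.mem_of_mem_erase (hS ha)) b hb hab with h | h
        · by_cases hbz : b = z
          · right; left; simp [hbz]
          · exact Or.inl (hScl a ha b (Finset.mem_erase.2 ⟨hbz, h⟩) hab)
        · exact Or.inr (Or.inr h)
    have fin : ∀ u ∈ A, u ≠ v → ∀ w ∈ C, G.Adj u w →
        2 ≤ (insert w (C.toFinset.filter (G.Adj v))).card → False := by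
      intro u hu huv w hw huw hc2
      obtain ⟨p, hp, hpA, hpl⟩ := long_path G A.card A v u (t + 1 - s) le_rfl hvA hu
        huv.symm hCA hCA2 (fun a ha _ => hdL a ha)
      have := gap hC hlen hno hp (fun a ha => (hA a (hpA a ha)).2) hw huw hc2
      have h3 := Finset.card_le_card (Finset.subset_insert w (C.toFinset.filter (G.Adj v)))
      omega
    by_cases hAv : A = {v}
    · have h1 := hdL v hvA
      have h3 : A.filter (G.Adj v) = ∅ := by
        rw [hAv]
        ext a
        simp
        rintro rfl
        exact G.loopless.irrefl _
      rw [h3, Finset.card_empty] at h1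
      obtain ⟨w, hw⟩ := Finset.card_pos.1 (show 0 < (C.toFinset.filter (G.Adj v)).card by omega)
      have hins := Finset.insert_eq_of_mem hw
      rw [Finset.mem_filter, List.mem_toFinset] at hw
      have := gap hC hlen hno (IsP.single G v) (by simpa using (hA v hvA).2) hw.1 hw.2
        (by rw [hins]; omega)
      rw [hins] at this
      simp at this
      omega
    · have hAe : (A.erase v).Nonempty := by
        rw [Finset.nonempty_iff_ne_empty]
        intro h
        rw [Finset.erase_eq_empty_iff] at h
        rcases h with h | h
        · exact hAne.ne_empty h
        · exact hAv h
      obtain ⟨c, hcC, -⟩ := hother v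
      obtain ⟨a, ha, b, hb, hbA, hab⟩ := (h2 v (hA v hvA).1).exists_edge (S := A.erase v) (c := c)
        (fun a ha => Finset.mem_erase.2 ⟨(Finset.mem_erase.1 ha).1,
          (hA a (Finset.mem_of_mem_erase ha)).1⟩) hAe
        (Finset.mem_erase.2 ⟨hAC v hvA c hcC, hCW c hcC⟩)
        (fun h => (hA c (Finset.mem_of_mem_erase h)).2 hcC)
      rw [Finset.mem_erase] at ha hb
      have hbC : b ∈ C := by
        rcases hcl a ha.2 b hb.2 hab with h | h
        · exact (hbA (Finset.mem_erase.2 ⟨hb.1, h⟩)).elim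
        · exact h
      by_cases hc2 : 2 ≤ (insert b (C.toFinset.filter (G.Adj v))).card
      · exact fin a ha.2 ha.1 b hbC hab hc2
      · have hle : (insert b (C.toFinset.filter (G.Adj v))).card ≤ 1 := by omega
        have hone : ∀ c ∈ C, G.Adj v c → c = b := by
          intro c hc hvc
          exact Finset.card_le_one.1 hle c (by simp [hc, hvc]) b (by simp)
        have h5 := hvmax a ha.2
        have h6 : 0 < (C.toFinset.filter (G.Adj a)).card :=
          Finset.card_pos.2 ⟨b, by simp [hbC, hab]⟩
        obtain ⟨b₀, hb₀⟩ := Finset.card_pos.1 (show 0 < s by omega)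
        rw [Finset.mem_filter, List.mem_toFinset] at hb₀
        have hvb : G.Adj v b := hone b₀ hb₀.1 hb₀.2 ▸ hb₀.2
        obtain ⟨c, hcC, hcb⟩ := hother b
        obtain ⟨a', ha', b', hb', hbA', hab'⟩ := (h2 b (hCW b hbC)).exists_edge (S := A) (c := c)
          (fun a ha => Finset.mem_erase.2 ⟨(hAC a ha b hbC).symm, (hA a ha).1⟩) hAne
          (Finset.mem_erase.2 ⟨hcb, hCW c hcC⟩) (fun h => (hA c h).2 hcC)
        rw [Finset.mem_erase] at hb'
        have hbC' : b' ∈ C := (hcl a' ha' b' hb'.2 hab').resolve_left hbA'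
        refine fin a' ha' ?_ b' hbC' hab' ?_
        · rintro rfl
          exact hb'.1 (hone b' hbC' hab')
        · rw [← Finset.card_pair hb'.1]
          apply Finset.card_le_card
          intro x hx
          simp only [Finset.mem_insert, Finset.mem_singleton] at hx
          rcases hx with rfl | rfl
          · simp
          · simp [hbC, hvb]
  · -- one attachment vertex
    obtain ⟨z, rfl⟩ := Finset.card_eq_one.1 (le_antisymm hZ1 hZpos)
    simp only [Finset.mem_singleton, forall_eq, Finset.card_singleton] at hZ hcl hmin
    obtain ⟨hzW, hzC, hzA⟩ := hZ
    have hLeq : A ∪ {z} = insert z A := by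
      rw [Finset.union_comm]; rfl
    rw [hLeq] at hdL
    have hCL : Conn G (insert z A) := by
      refine conn_of_base (r := z) (by simp) ?_
      intro S hS hSne hzS hScl
      have hSA : S ⊆ A := by
        intro a ha
        rcases Finset.mem_insert.1 (hS ha) with rfl | h
        · exact (hzS ha).elim
        · exact h
      have := hmin (S, ∅) ⟨hSne, fun a ha => hA a (hSA ha), by simp, by simp, ?_⟩
      · have h3 := Finset.card_le_card hSA
        simp only [Finset.card_empty, Nat.add_zero] at this
        omega
      · intro a ha b hb hab
        rcases hcl a (hSA ha) b hb hab with h | h | h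
        · exact Or.inl (hScl a ha b (by simp [h]) hab)
        · exact Or.inl (hScl a ha b (by simp [h]) hab)
        · exact Or.inr (Or.inr h)
    have hCL2 : ∀ z' ∈ insert z A, Conn G ((insert z A).erase z') := by
      intro z' hz'
      rcases Finset.mem_insert.1 hz' with rfl | hz'A
      · rw [Finset.erase_insert hzA]
        intro S hS hSne hScl
        have := hmin (S, {z'}) ⟨hSne, fun a ha => hA a (hS ha), ?_, by simp, ?_⟩
        · simp only [Finset.card_singleton] at this
          exact (Finset.eq_of_subset_of_card_le hS (by omega)).ge
        · intro a ha
          simp only [Finset.mem_singleton] at ha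
          subst ha
          exact ⟨hzW, hzC, fun h => hzA (hS h)⟩
        · intro a ha b hb hab
          rcases hcl a (hS ha) b hb hab with h | h | h
          · exact Or.inl (hScl a ha b h hab)
          · exact Or.inr (Or.inl (by simp [h]))
          · exact Or.inr (Or.inr h)
      · have hz'z : z ≠ z' := fun h => hzA (h ▸ hz'A)
        refine conn_of_base (r := z) (by simp [hz'z]) ?_
        intro S hS hSne hzS hScl
        have hSA : S ⊆ A.erase z' := by
          intro a ha
          have := hS ha
          rw [Finset.mem_erase, Finset.mem_insert] at this
          rw [Finset.mem_erase]
          refine ⟨this.1, this.2.resolve_left ?_⟩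
          rintro rfl
          exact hzS ha
        have := hmin (S, {z'}) ⟨hSne, fun a ha => hA a (Finset.mem_of_mem_erase (hSA ha)), ?_,
          by simp, ?_⟩
        · have h3 := Finset.card_le_card hSA
          have h4 := Finset.card_erase_lt_of_mem hz'A
          simp only [Finset.card_singleton] at this
          omega
        · intro a ha
          simp only [Finset.mem_singleton] at ha
          subst ha
          exact ⟨(hA a hz'A).1, (hA a hz'A).2, fun h => by simpa using hS h⟩
        · intro a ha b hb hab
          by_cases hbz : b = z'
          · right; left; simp [hbz]
          rcases hcl a (Finset.mem_of_mem_erase (hSA ha)) b hb hab with h | h | h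
          · exact Or.inl (hScl a ha b (by simp [h, hbz]) hab)
          · subst h
            exact Or.inl (hScl a ha b (by simp [hbz]) hab)
          · exact Or.inr (Or.inr h)
    set D := (W.filter (· ∉ C)) \ A with hD
    have hDmem : ∀ a, a ∈ D ↔ (a ∈ W ∧ a ∉ C) ∧ a ∉ A := by
      intro a
      simp [hD]
    have hzD : z ∈ D := (hDmem z).2 ⟨⟨hzW, hzC⟩, hzA⟩
    set R := Reach G D z with hR
    have hRD : ∀ a ∈ R, a ∈ D := fun a ha => Reach_subset ha
    have fin : ∀ v' ∈ A, s ≤ (C.toFinset.filter (G.Adj v')).card → ∀ y ∈ R, ∀ w ∈ C, G.Adj y w →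
        2 ≤ (insert w (C.toFinset.filter (G.Adj v'))).card → False := by
      intro v' hv' hsv' y hy w hw hyw hc2
      obtain ⟨p, hp, hpA, hpl⟩ := long_path G (insert z A).card (insert z A) v' z (t + 1 - s) le_rfl
        (by simp [hv']) (by simp) (fun h => hzA (h ▸ hv')) hCL hCL2
        (fun a ha haz => hdL a ((Finset.mem_insert.1 ha).resolve_left haz))
      obtain ⟨q, hq, hqD⟩ := mem_Reach.1 hy
      obtain ⟨r, hr, hrlen, hrmem⟩ := hp.trans hq (by
        intro a ha haq
        exact (Finset.mem_insert.1 (hpA a ha)).resolve_right ((hDmem a).1 (hqD a haq)).2)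
      have := gap hC hlen hno hr (by
        intro a ha
        rcases hrmem a ha with h | h
        · rcases Finset.mem_insert.1 (hpA a h) with rfl | h
          · exact hzC
          · exact (hA a h).2
        · exact ((hDmem a).1 (hqD a h)).1.2) hw hyw hc2
      have h3 := Finset.card_le_card (Finset.subset_insert w (C.toFinset.filter (G.Adj v')))
      omega
    -- `z` has a neighbour elsewhere
    have hp : ∃ p ∈ W, G.Adj z p ∧ p ∉ insert z A ∧ p ∉ C := by
      by_contra hcon
      push Not at hcon
      have := hmin (insert z A, ∅) ⟨by simp, ?_, by simp, by simp, ?_⟩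
      · simp only [Finset.card_empty, Nat.add_zero, Finset.card_insert_of_notMem hzA] at this
        omega
      · intro a ha
        rcases Finset.mem_insert.1 ha with rfl | ha
        · exact ⟨hzW, hzC⟩
        · exact hA a ha
      · intro a ha b hb hab
        rcases Finset.mem_insert.1 ha with rfl | ha
        · by_cases hbL : b ∈ insert a A
          · exact Or.inl hbL
          · exact Or.inr (Or.inr (hcon b hb hab hbL))
        · rcases hcl a ha b hb hab with h | h | h
          · left; simp [h]
          · left; simp [h]
          · exact Or.inr (Or.inr h)
    obtain ⟨p, hpW, hzp, hpL, hpC⟩ := hp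
    simp only [Finset.mem_insert, not_or] at hpL
    have hpR : p ∈ R := Reach_closed (self_mem_Reach hzD) ((hDmem p).2 ⟨⟨hpW, hpC⟩, hpL.2⟩) hzp
    -- leaving `R` without returning to `A`
    have hleave : ∀ a ∈ R, ∀ b ∈ W, b ∉ R → G.Adj a b → b ∈ A ∨ b ∈ C := by
      intro a ha b hb hbR hab
      by_contra hcon
      push Not at hcon
      exact hbR (Reach_closed ha ((hDmem b).2 ⟨⟨hb, hcon.2⟩, hcon.1⟩) hab)
    obtain ⟨c, hcC, -⟩ := hother z
    have hcz : c ≠ z := fun h => hzC (h ▸ hcC)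
    obtain ⟨y, hy, w, hw, hwR, hyw⟩ := (h2 z hzW).exists_edge (S := R.erase z) (c := c)
      (fun a ha => Finset.mem_erase.2 ⟨(Finset.mem_erase.1 ha).1,
        ((hDmem a).1 (hRD a (Finset.mem_of_mem_erase ha))).1.1⟩)
      ⟨p, Finset.mem_erase.2 ⟨hpL.1, hpR⟩⟩
      (Finset.mem_erase.2 ⟨hcz, hCW c hcC⟩)
      (fun h => ((hDmem c).1 (hRD c (Finset.mem_of_mem_erase h))).1.2 hcC)
    rw [Finset.mem_erase] at hy hw
    have hyD := (hDmem y).1 (hRD y hy.2)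
    have hwC : w ∈ C := by
      rcases hleave y hy.2 w hw.2 (fun h => hwR (Finset.mem_erase.2 ⟨hw.1, h⟩)) hyw with h | h
      · exfalso
        rcases hcl w h y hyD.1.1 hyw.symm with h' | h' | h'
        · exact hyD.2 h'
        · exact hy.1 h'
        · exact hyD.1.2 h'
      · exact h
    by_cases hc2 : 2 ≤ (insert w (C.toFinset.filter (G.Adj v))).card
    · exact fin v hvA le_rfl y hy.2 w hwC hyw hc2
    have hle : (insert w (C.toFinset.filter (G.Adj v))).card ≤ 1 := by omega
    have hs1 : s ≤ 1 := (Finset.card_le_card (Finset.subset_insert _ _)).trans hle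
    have hone : ∀ c ∈ C, G.Adj v c → c = w := by
      intro c hc hvc
      exact Finset.card_le_one.1 hle c (by simp [hc, hvc]) w (by simp)
    -- `A` has a neighbour on the cycle
    have hvw : G.Adj v w := by
      obtain ⟨a, ha, b, hb, hbA, hab⟩ := (h2 z hzW).exists_edge (S := A) (c := c)
        (fun a ha => Finset.mem_erase.2 ⟨fun h => hzA (h ▸ ha), (hA a ha).1⟩) hAne
        (Finset.mem_erase.2 ⟨hcz, hCW c hcC⟩) (fun h => (hA c h).2 hcC)
      rw [Finset.mem_erase] at hb
      have hbC : b ∈ C := by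
        rcases hcl a ha b hb.2 hab with h | h | h
        · exact (hbA h).elim
        · exact (hb.1 h).elim
        · exact h
      have h5 := hvmax a ha
      have h6 : 0 < (C.toFinset.filter (G.Adj a)).card :=
        Finset.card_pos.2 ⟨b, by simp [hbC, hab]⟩
      obtain ⟨b₀, hb₀⟩ := Finset.card_pos.1 (show 0 < s by omega)
      rw [Finset.mem_filter, List.mem_toFinset] at hb₀
      exact hone b₀ hb₀.1 hb₀.2 ▸ hb₀.2
    have two : ∀ (x : V) (F : Finset V) (y : V), y ∈ F → y ≠ x → 2 ≤ (insert x F).card := by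
      intro x F y hy hyx
      rw [← Finset.card_pair hyx]
      apply Finset.card_le_card
      intro a ha
      simp only [Finset.mem_insert, Finset.mem_singleton] at ha ⊢
      rcases ha with rfl | rfl
      · exact Or.inr hy
      · exact Or.inl rfl
    obtain ⟨c', hcC', hcw'⟩ := hother w
    obtain ⟨a, ha, b, hb, hbA, hab⟩ := (h2 w hw.2).exists_edge (S := A ∪ R) (c := c')
      (by
        intro a ha
        rw [Finset.mem_erase]
        rcases Finset.mem_union.1 ha with h | h
        · exact ⟨(hAC a h w hwC).symm, (hA a h).1⟩
        · have := (hDmem a).1 (hRD a h)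
          exact ⟨fun h => this.1.2 (h ▸ hwC), this.1.1⟩)
      (hAne.mono Finset.subset_union_left)
      (Finset.mem_erase.2 ⟨hcw', hCW c' hcC'⟩)
      (by
        intro h
        rcases Finset.mem_union.1 h with h | h
        · exact (hA c' h).2 hcC'
        · exact ((hDmem c').1 (hRD c' h)).1.2 hcC')
    rw [Finset.mem_erase] at hb
    rw [Finset.mem_union, not_or] at hbA
    rcases Finset.mem_union.1 ha with ha | ha
    · have hbC : b ∈ C := by
        rcases hcl a ha b hb.2 hab with h | h | h
        · exact (hbA.1 h).elim
        · subst h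
          exact (hbA.2 (self_mem_Reach hzD)).elim
        · exact h
      have hbm : b ∈ C.toFinset.filter (G.Adj a) := by simp [hbC, hab]
      have h6 : 0 < (C.toFinset.filter (G.Adj a)).card := Finset.card_pos.2 ⟨b, hbm⟩
      exact fin a ha (by omega) y hy.2 w hwC hyw (two _ _ b hbm hb.1)
    · have hbC : b ∈ C := (hleave a ha b hb.2 hbA.2 hab).resolve_left hbA.1
      exact fin v hvA le_rfl a ha b hbC hab (two _ _ w (by simp [hwC, hvw]) hb.1.symm)

theorem isP_of_path {G : SimpleGraph V} {x y : V} {p : G.Walk x y} (hp : p.IsPath) :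
    IsP G x p.support y := by
  refine ⟨p.isChain_adj_support, hp.support_nodup, ?_, ?_⟩
  · rw [List.head?_eq_some_head p.support_ne_nil]
    simp
  · rw [List.getLast?_eq_some_getLast p.support_ne_nil]
    simp

theorem IsP.exists_walk {G : SimpleGraph V} {p : List V} : ∀ {x y : V}, IsP G x p y →
    ∃ q : G.Walk x y, q.support = p := by
  induction p with
  | nil => intro x y h; simpa using h.head
  | cons a l ih =>
    intro x y h
    have hx : a = x := by simpa using h.head
    subst hx
    cases l with
    | nil =>
      have hy : a = y := by simpa using h.last
      subst hy
      exact ⟨Walk.nil, by simp⟩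
    | cons b l =>
      have hc := List.isChain_cons_cons.1 h.chain
      obtain ⟨q, hq⟩ := ih (x := b) (y := y) ⟨hc.2, (List.nodup_cons.1 h.nodup).2, by simp,
        by simpa using h.last⟩
      exact ⟨Walk.cons hc.1 q, by simp [hq]⟩

theorem cyc_of_walk {G : SimpleGraph V} {v : V} {w : G.Walk v v} (hw : w.IsCycle) :
    ∃ p, IsCyc G p ∧ p.length = w.length := by
  have h3 := hw.three_le_length
  cases w with
  | nil => simp at h3
  | @cons _ x _ h p =>
    have hp := ((Walk.cons_isCycle_iff p h).1 hw).1
    refine ⟨p.support, ⟨x, v, isP_of_path hp, h, ?_⟩, ?_⟩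
    · simp at h3 ⊢; omega
    · simp

theorem walk_of_cyc {G : SimpleGraph V} {p : List V} (hp : IsCyc G p) :
    ∃ (v : V) (w : G.Walk v v), w.IsCycle ∧ w.length = p.length := by
  obtain ⟨x, y, hP, hyx, h3⟩ := hp
  obtain ⟨q, rfl⟩ := hP.exists_walk
  have hq : q.IsPath := Walk.IsPath.mk' hP.nodup
  refine ⟨y, Walk.cons hyx q, ?_, by simp⟩
  rw [Walk.cons_isCycle_iff]
  refine ⟨hq, fun h => ?_⟩
  rw [Sym2.eq_swap] at h
  have := hq.length_eq_one_of_mem_edges h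
  simp at h3
  omega

theorem conn_of_induce [Fintype V] [DecidableEq V] {G : SimpleGraph V} {z : V}
    (h : (G.induce ({z}ᶜ : Set V)).Connected) : Conn G (Finset.univ.erase z) := by
  intro S hS hSne hcl b hb
  obtain ⟨a, ha⟩ := hSne
  have haz : a ≠ z := (Finset.mem_erase.1 (hS ha)).1
  have hbz : b ≠ z := (Finset.mem_erase.1 hb).1
  have key : ∀ (c d : ({z}ᶜ : Set V)), (G.induce ({z}ᶜ : Set V)).Walk c d → c.1 ∈ S → d.1 ∈ S := by
    intro c d q
    induction q with
    | nil => exact id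
    | @cons c d e hcd q ih =>
      intro hc
      refine ih (hcl c.1 hc d.1 ?_ hcd)
      exact Finset.mem_erase.2 ⟨fun h => d.2 h, Finset.mem_univ _⟩
  obtain ⟨q⟩ := h.preconnected ⟨a, by simpa using haz⟩ ⟨b, by simpa using hbz⟩
  exact key _ _ q ha

/-- The edges inside `W` with an end off `C`. -/
noncomputable def edgesOff [Fintype V] (G : SimpleGraph V) (W : Finset V) (C : List V) :
    Finset (Sym2 V) := by
  classical
  exact Finset.univ.filter fun e => e ∈ G.edgeSet ∧ (∀ x ∈ e, x ∈ W) ∧ ∃ x ∈ e, x ∉ C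

theorem mem_edgesOff [Fintype V] {G : SimpleGraph V} {W : Finset V} {C : List V} {e : Sym2 V} :
    e ∈ edgesOff G W C ↔ e ∈ G.edgeSet ∧ (∀ x ∈ e, x ∈ W) ∧ ∃ x ∈ e, x ∉ C := by
  classical
  unfold edgesOff
  simp

theorem main_bound [Fintype V] {t : ℕ} (ht : 1 ≤ t) {C : List V} (hlen : C.length = 2 * t + 1)
    (n : ℕ) : ∀ (G : SimpleGraph V) (W : Finset V), W.card ≤ n → IsCyc G C →
      (∀ p, IsCyc G p → p.length ≤ 2 * t + 1) → (∀ a ∈ C, a ∈ W) →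
      (open Classical in ∀ z ∈ W, Conn G (W.erase z)) →
      (edgesOff G W C).card + t * (2 * t + 1) ≤ t * W.card := by
  classical
  have hbase : ∀ (G : SimpleGraph V) (W : Finset V), IsCyc G C → (∀ a ∈ C, a ∈ W) →
      (∀ v ∈ W, v ∈ C) → (edgesOff G W C).card + t * (2 * t + 1) ≤ t * W.card := by
    intro G W hC hCW hWC
    have h0 : edgesOff G W C = ∅ := by
      rw [Finset.eq_empty_iff_forall_notMem]
      intro e he
      obtain ⟨-, h1, x, hx, hxC⟩ := mem_edgesOff.1 he
      exact hxC (hWC x (h1 x hx))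
    have h1 : 2 * t + 1 ≤ W.card := by
      obtain ⟨x, y, hP, -⟩ := hC
      rw [← hlen, ← List.toFinset_card_of_nodup hP.nodup]
      exact Finset.card_le_card fun a ha => hCW a (by simpa using ha)
    rw [h0, Finset.card_empty, Nat.zero_add]
    exact Nat.mul_le_mul_left t h1
  induction n with
  | zero =>
    intro G W hW hC _ hCW _
    rw [Nat.le_zero, Finset.card_eq_zero] at hW
    subst hW
    exact hbase G ∅ hC hCW (by simp)
  | succ n ih =>
    intro G W hW hC hno hCW h2
    by_cases hWC : ∀ v ∈ W, v ∈ C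
    · exact hbase G W hC hCW hWC
    push Not at hWC
    obtain ⟨v₀, hv₀, hv₀C⟩ := hWC
    have hv : ∃ v ∈ W, v ∉ C ∧ (W.filter (G.Adj v)).card ≤ t := by
      by_contra hcon
      push Not at hcon
      exact mindeg_contra ht hC hlen hno hCW h2 hv₀ hv₀C
        (fun v hv hvC => hcon v hv hvC)
    obtain ⟨v, hvW, hvC, hdv⟩ := hv
    -- two vertices of the cycle
    have hrs : ∃ r ∈ C, ∃ s ∈ C, s ≠ r := by
      obtain ⟨x, y, hP, hyx, -⟩ := hC
      exact ⟨x, hP.mem_head, y, hP.mem_last, hyx.ne⟩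
    obtain ⟨r, hr, s, hs, hsr⟩ := hrs
    obtain ⟨u, huW, hvu, hcon⟩ := exists_contractible h2 hvW (hCW r hr)
      (fun h => hvC (h ▸ hr)) (hCW s hs) (fun h => hvC (h ▸ hs)) hsr
    have hne : ∀ a ∈ C, a ≠ v := fun a ha h => hvC (h ▸ ha)
    have hcv := Finset.card_erase_of_mem hvW
    have hpos := Finset.card_pos.2 ⟨v, hvW⟩
    have hI := ih (contract G v u) (W.erase v) (by omega) ?_ ?_
      (fun a ha => Finset.mem_erase.2 ⟨hne a ha, hCW a ha⟩)
      (contract_conn h2 hvW huW hvu hcon)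
    · have hsub : edgesOff G W C ⊆ edgesOff (contract G v u) (W.erase v) C ∪
          (W.filter (G.Adj v)).image (fun b => s(v, b)) := by
        intro e he
        obtain ⟨h1, h3, h4⟩ := mem_edgesOff.1 he
        rw [Finset.mem_union]
        by_cases hve : v ∈ e
        · right
          obtain ⟨b, rfl⟩ := Sym2.mem_iff_exists.1 hve
          refine Finset.mem_image.2 ⟨b, Finset.mem_filter.2 ⟨h3 b (by simp), ?_⟩, rfl⟩
          simpa using h1
        · left
          refine mem_edgesOff.2 ⟨?_, fun x hx => Finset.mem_erase.2
            ⟨fun h => hve (h ▸ hx), h3 x hx⟩, h4⟩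
          induction e with
          | h a b =>
            rw [SimpleGraph.mem_edgeSet] at h1 ⊢
            simp only [Sym2.mem_iff, not_or] at hve
            exact contract_adj_of h1 (Ne.symm hve.1) (Ne.symm hve.2)
      have h5 := (Finset.card_le_card hsub).trans (Finset.card_union_le _ _)
      have h6 := Finset.card_image_le (s := W.filter (G.Adj v)) (f := fun b => s(v, b))
      have h7 : t * W.card = t * (W.erase v).card + t := by
        have : W.card = (W.erase v).card + 1 := by omega
        rw [this]; ring
      omega
    · obtain ⟨x, y, hP, hyx, h3⟩ := hC
      refine ⟨x, y, ⟨hP.chain.imp_of_mem_imp ?_, hP.nodup, hP.head, hP.last⟩, ?_, h3⟩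
      · intro a b ha hb hab
        exact contract_adj_of hab (hne a ha) (hne b hb)
      · exact contract_adj_of hyx (hne _ hP.mem_last) (hne _ hP.mem_head)
    · intro p hp
      obtain ⟨q, hq, hpq⟩ := contract_cyc hvu hp
      exact hpq.trans (hno q hq)

theorem inner_bound {V α : Type*} [Fintype V] {F : SimpleGraph α} {B : SimpleGraph V}
    (hBF : ¬ ContainsCopy F B) {C : List V} (hn : C.Nodup) {m : ℕ} (hm : C.length = m) :
    {e ∈ B.edgeSet | ∀ x ∈ e, x ∈ C}.ncard ≤ exMax m (fun G => ¬ ContainsCopy F G) := by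
  subst hm
  have hinj : Function.Injective C.get := List.nodup_iff_injective_get.1 hn
  have h1 : {e ∈ B.edgeSet | ∀ x ∈ e, x ∈ C} ⊆
      (Sym2.map C.get) '' (B.comap C.get).edgeSet := by
    rintro e ⟨he, hC⟩
    induction e with
    | h a b =>
      obtain ⟨i, rfl⟩ := List.get_of_mem (hC a (by simp))
      obtain ⟨j, rfl⟩ := List.get_of_mem (hC b (by simp))
      exact ⟨s(i, j), by simpa using he, by simp⟩
  have h2 : {e ∈ B.edgeSet | ∀ x ∈ e, x ∈ C}.ncard ≤ edgeCount (B.comap C.get) :=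
    (Set.ncard_le_ncard h1 (Set.toFinite _)).trans (Set.ncard_image_le (Set.toFinite _))
  refine h2.trans (le_csSup ?_ ⟨B.comap C.get, ?_, rfl⟩)
  · refine ⟨(Set.univ : Set (Sym2 (Fin C.length))).ncard, ?_⟩
    rintro x ⟨G, -, rfl⟩
    exact Set.ncard_le_ncard (Set.subset_univ _) (Set.toFinite _)
  · rintro ⟨f, hf, hfa⟩
    exact hBF ⟨fun a => C.get (f a), hinj.comp hf, fun a b hab => hfa hab⟩

end BlockBound

/-- Block edge bound: for even `k ≥ 6` and a 2-connected graph `B` on `b ≥ k`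
vertices with no cycle of length `≥ k`, no copy of `F`, and longest cycle of
length exactly `k−1`,
`e(B) ≤ ex(k-1,F) + ((k-2)/2)·(b − 1) − (k-2)²/2`. -/
theorem stmt17 {V α : Type*} [Fintype V] [Fintype α]
    (k : ℕ) (hk : 6 ≤ k) (hkeven : Even k) (F : SimpleGraph α)
    (B : SimpleGraph V) (hB2 : TwoConnected B) (hb : k ≤ Fintype.card V)
    (hBk : ¬ HasCycleGE B k) (hBF : ¬ ContainsCopy F B)
    (v : V) (w : B.Walk v v) (hw : w.IsCycle) (hlen : w.length = k - 1)
    (hlongest : ∀ (x : V) (w' : B.Walk x x), w'.IsCycle → w'.length ≤ k - 1) :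
    (edgeCount B : ℝ)
      ≤ (exMax (k - 1) (fun G => ¬ ContainsCopy F G) : ℝ)
        + ((k : ℝ) - 2) / 2 * ((Fintype.card V : ℝ) - 1)
        - ((k : ℝ) - 2) ^ 2 / 2 := by
  classical
  obtain ⟨C, hC, hCl⟩ := BlockBound.cyc_of_walk hw
  obtain ⟨m, hm⟩ := hkeven
  obtain ⟨t, rfl⟩ : ∃ t, m = t + 1 := ⟨m - 1, by omega⟩
  have hCl' : C.length = 2 * t + 1 := by omega
  have hmain := BlockBound.main_bound (t := t) (by omega) hCl' (Fintype.card V) B Finset.univ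
    (by simp) hC (by
      intro p hp
      obtain ⟨x, w', hw', hl⟩ := BlockBound.walk_of_cyc hp
      have := hlongest x w' hw'
      omega) (by simp) (fun z _ => BlockBound.conn_of_induce (hB2.2.2 z))
  have hnod : C.Nodup := by
    obtain ⟨x, y, hP, -⟩ := hC
    exact hP.nodup
  have hinner := BlockBound.inner_bound hBF hnod (m := k - 1) (by omega)
  have hsub : B.edgeSet ⊆ (↑(BlockBound.edgesOff B Finset.univ C) : Set (Sym2 V)) ∪
      {e ∈ B.edgeSet | ∀ x ∈ e, x ∈ C} := by
    intro e he
    by_cases h : ∀ x ∈ e, x ∈ C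
    · exact Or.inr ⟨he, h⟩
    · push Not at h
      exact Or.inl (Finset.mem_coe.2 (BlockBound.mem_edgesOff.2 ⟨he, by simp, h⟩))
  have hcount : edgeCount B ≤ (BlockBound.edgesOff B Finset.univ C).card +
      exMax (k - 1) (fun G => ¬ ContainsCopy F G) := by
    have h1 := (Set.ncard_le_ncard hsub (Set.toFinite _)).trans (Set.ncard_union_le _ _)
    rw [Set.ncard_coe_finset] at h1
    unfold edgeCount
    omega
  rw [Finset.card_univ] at hmain
  have e1 : (k : ℝ) = 2 * (t : ℝ) + 2 := by
    rw [hm]; push_cast; ring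
  have hmain' : ((BlockBound.edgesOff B Finset.univ C).card : ℝ) + t * (2 * t + 1) ≤
      t * (Fintype.card V : ℝ) := by exact_mod_cast hmain
  have hcount' : (edgeCount B : ℝ) ≤ ((BlockBound.edgesOff B Finset.univ C).card : ℝ) +
      (exMax (k - 1) (fun G => ¬ ContainsCopy F G) : ℝ) := by exact_mod_cast hcount
  rw [e1]
  have e2 : (2 * (t : ℝ) + 2 - 2) / 2 * ((Fintype.card V : ℝ) - 1) - (2 * (t : ℝ) + 2 - 2) ^ 2 / 2
      = t * (Fintype.card V : ℝ) - t * (2 * t + 1) := by ring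
  linarith
end
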